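/- Let m > r be positive integers, A ∈ ℤ^{r×m} a positive and abundant integer matrix, and b ∈ ℤ^r such that S(A,b) ≠ ∅. For each n let p = p(n) ∈ [0,1] and let X_n = |S_0(A,b) ∩ [n]_p^m| be the number of proper solutions x to Ax = b with all entries in the random set [n]_p. If n(1−p) → ∞ and n·p^{c(A)} → ∞ as n → ∞, then the normalized random variable X̃_n = (X_n − E[X_n])/√(Var X_n) converges in distribution to the standard normal law 𝒩(0,1). -/

import Mathlib

open Matrix Finset MeasureTheory ProbabilityTheory Filter Topology
open scoped BoundedContinuousFunction NNReal ENNReal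

attribute [local instance] Classical.propDecidable

noncomputable section

/-- The rank over `ℚ` of an integer matrix. -/
def rkZ {α β : Type*} [Fintype α] [Fintype β] (A : Matrix α β ℤ) : ℕ :=
  (A.map (Int.cast : ℤ → ℚ)).rank

/-- The submatrix consisting of the columns indexed by `Q`. -/
def colSub {α β : Type*} (A : Matrix α β ℤ) (Q : Finset β) : Matrix α Q ℤ :=
  A.submatrix id (fun j => (j : β))

/-- A matrix is positive if `Ax = 0` has a solution with all entries positive and,
for every pair of distinct indices, a solution whose corresponding entries differ. -/
def IsPositiveMat {α β : Type*} [Fintype β] (A : Matrix α β ℤ) : Prop :=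
  (∃ x : β → ℤ, A.mulVec x = 0 ∧ ∀ j, 0 < x j) ∧
    ∀ i j : β, i ≠ j → ∃ x : β → ℤ, A.mulVec x = 0 ∧ x i ≠ x j

/-- A matrix is abundant if it has positive rank and removing at most two columns
does not change the rank. -/
def IsAbundantMat {α β : Type*} [Fintype α] [Fintype β] (A : Matrix α β ℤ) : Prop :=
  0 < rkZ A ∧ ∀ Q : Finset β, Fintype.card β - 2 ≤ Q.card → rkZ (colSub A Q) = rkZ A

/-- `r_Q(A) = rk(A) - rk(A^{complement of Q})`. -/
def rQ {α β : Type*} [Fintype α] [Fintype β] (A : Matrix α β ℤ) (Q : Finset β) : ℕ :=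
  rkZ A - rkZ (colSub A Qᶜ)

/-- The density `c(A) = max over nonempty Q of |Q|/(|Q| - r_Q(A))`. -/
def matDensity {α β : Type*} [Fintype α] [Fintype β] (A : Matrix α β ℤ) : ℝ :=
  sSup {x : ℝ | ∃ Q : Finset β, Q.Nonempty ∧
    x = (Q.card : ℝ) / ((Q.card : ℝ) - (rQ A Q : ℝ))}

/-- The matrix `A_𝔭` obtained by summing columns over the classes of a partition
(realised as a setoid); columns are indexed by the classes. -/
def contract {α β : Type*} [Fintype β] (A : Matrix α β ℤ) (s : Setoid β) :
    Matrix α (Quotient s) ℤ :=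
  fun i c => ∑ j ∈ Finset.univ.filter (fun j => Quotient.mk s j = c), A i j

/-- `𝔓(A)`: partitions whose contracted matrix has full rank `rk(A)`. -/
def partitionFamily {α β : Type*} [Fintype α] [Fintype β] (A : Matrix α β ℤ) :
    Set (Setoid β) :=
  {s | rkZ (contract A s) = rkZ A}

/-- The partition of `β` into singletons, as a setoid. -/
def singletonSetoid (β : Type*) : Setoid β := ⟨Eq, eq_equivalence⟩

/-- Proper solutions: solutions with pairwise distinct coordinates. -/
def properSols {α β : Type*} [Fintype β] (A : Matrix α β ℤ) (b : α → ℤ) : Set (β → ℤ) :=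
  {x | A.mulVec x = b ∧ Function.Injective x}

/-- Type-`𝔓` solutions: solutions whose induced partition (the kernel setoid) lies in `𝔓`. -/
def typeSols {α β : Type*} [Fintype β] (A : Matrix α β ℤ) (b : α → ℤ)
    (P : Set (Setoid β)) : Set (β → ℤ) :=
  {x | A.mulVec x = b ∧ Setoid.ker x ∈ P}

/-- The Bernoulli measure on `Bool` with parameter `p`. -/
def bern (p : ℝ≥0) (h : p ≤ 1) : Measure Bool :=
  (PMF.bernoulli p (by exact_mod_cast h)).toMeasure

/-- The product Bernoulli measure on `Fin n → Bool`, modelling the random set `[n]_p`. -/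
def prodBern (n : ℕ) (p : ℝ≥0) (h : p ≤ 1) : Measure (Fin n → Bool) :=
  Measure.pi fun _ => bern p h

/-- An integer `a` is a selected element of `[n]_p` in outcome `ω`. -/
def selected {n : ℕ} (ω : Fin n → Bool) (a : ℤ) : Prop :=
  ∃ i : Fin n, a = (i : ℕ) + 1 ∧ ω i = true

/-- The number of solutions in `S` whose entries all lie in the random set `[n]_p`. -/
def solCount {β : Type*} (S : Set (β → ℤ)) (n : ℕ) (ω : Fin n → Bool) : ℕ :=
  Nat.card {x : β → ℤ // x ∈ S ∧ ∀ j, selected ω (x j)}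

end


section Tikhomirov

lemma exp2_bound (x : ℝ) : ‖Complex.exp (x * Complex.I) - 1 - x * Complex.I‖ ≤ 2 * x ^ 2 := by
  by_cases hx : |x| ≤ 1
  · have h : ‖(x * Complex.I : ℂ)‖ ≤ 1 := by simpa using hx
    have := Complex.norm_exp_sub_one_sub_id_le h
    have h2 : ‖(x * Complex.I : ℂ)‖ ^ 2 = x ^ 2 := by simp
    rw [h2] at this
    nlinarith [sq_nonneg x]
  · push Not at hx
    have h1 : ‖Complex.exp (x * Complex.I) - 1‖ ≤ |x| := by
      have := Real.norm_exp_I_mul_ofReal_sub_one_le (x := x)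
      rw [mul_comm] at this
      simpa using this
    calc _ ≤ ‖Complex.exp (x * Complex.I) - 1‖ + ‖(x * Complex.I : ℂ)‖ := norm_sub_le _ _
      _ ≤ |x| + |x| := by gcongr; simp
      _ ≤ 2 * x ^ 2 := by rw [← sq_abs x]; nlinarith

lemma exp1_bound (x y : ℝ) :
    ‖Complex.exp (x * Complex.I) - Complex.exp (y * Complex.I)‖ ≤ |x - y| := by
  have h : Complex.exp (x * Complex.I) - Complex.exp (y * Complex.I)
      = Complex.exp (y * Complex.I) * (Complex.exp (Complex.I * ((x - y : ℝ) : ℂ)) - 1) := by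
    rw [mul_sub, ← Complex.exp_add, mul_one]
    congr 2
    push_cast; ring
  rw [h, norm_mul, Complex.norm_exp_ofReal_mul_I, one_mul]
  simpa using Real.norm_exp_I_mul_ofReal_sub_one_le (x := x - y)

variable {Ω : Type*} [MeasurableSpace Ω] [Finite Ω] [DiscreteMeasurableSpace Ω]

/-- The characteristic function of `W`. -/
noncomputable def cf (μ : Measure Ω) (W : Ω → ℝ) (t : ℝ) : ℂ :=
  ∫ ω, Complex.exp (((t * W ω : ℝ) : ℂ) * Complex.I) ∂μ

/-- The triple error sum of the local dependence bound. -/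
noncomputable def tripleErr {ι : Type*} (μ : Measure Ω) (s : Finset ι) (R : ι → ι → Prop) (X : ι → Ω → ℝ) : ℝ :=
  ∑ i ∈ s, ∑ j ∈ s with R i j, ∑ k ∈ s with R i k ∨ R j k,
    ((∫ ω, |X i ω * X j ω * X k ω| ∂μ) + (∫ ω, |X i ω * X j ω| ∂μ) * ∫ ω, |X k ω| ∂μ)

lemma indep_factor (μ : Measure Ω) [IsProbabilityMeasure μ] (Y V : Ω → ℝ) (h : IndepFun Y V μ)
    (t : ℝ) : ∫ ω, (Y ω : ℂ) * Complex.exp (((t * V ω : ℝ) : ℂ) * Complex.I) ∂μ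
      = ((∫ ω, Y ω ∂μ : ℝ) : ℂ) * cf μ V t := by
  have := h.integral_fun_comp_mul_comp (f := fun y : ℝ => (y : ℂ))
    (g := fun v : ℝ => Complex.exp (((t * v : ℝ) : ℂ) * Complex.I))
    (Measurable.of_discrete.aemeasurable) (Measurable.of_discrete.aemeasurable)
    (by fun_prop) (by fun_prop)
  rw [this, integral_complex_ofReal]; rfl

lemma tikh_term1 {ι : Type*} (μ : Measure Ω) [IsProbabilityMeasure μ]
    (s : Finset ι) (R : ι → ι → Prop) (X : ι → Ω → ℝ) (i : ι)
    (h0 : ∫ ω, X i ω ∂μ = 0)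
    (hind : IndepFun (X i) (fun ω => ∑ j ∈ s with ¬ R i j, X j ω) μ) (t : ℝ) :
    ‖(∫ ω, (X i ω : ℂ) * Complex.exp (((t * ∑ j ∈ s, X j ω : ℝ) : ℂ) * Complex.I) ∂μ)
      - (t * Complex.I) * ∑ j ∈ s with R i j, ∫ ω, ((X i ω * X j ω : ℝ) : ℂ) *
          Complex.exp (((t * ∑ j ∈ s, X j ω : ℝ) : ℂ) * Complex.I) ∂μ‖
      ≤ 2 * t ^ 2 * ∑ j ∈ s with R i j, ∑ k ∈ s with R i k, ∫ ω, |X i ω * X j ω * X k ω| ∂μ := by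
  set W : Ω → ℝ := fun ω => ∑ j ∈ s, X j ω with hW
  set V : Ω → ℝ := fun ω => ∑ j ∈ s with ¬ R i j, X j ω with hV
  set Z : Ω → ℝ := fun ω => ∑ j ∈ s with R i j, X j ω with hZ
  have hsum : ∀ ω, W ω = Z ω + V ω := fun ω => by
    simp only [hW, hV, hZ]; rw [Finset.sum_filter_add_sum_filter_not]
  have hf := indep_factor μ (X i) V hind t
  rw [h0] at hf
  simp only [Complex.ofReal_zero, zero_mul] at hf
  have hrew : (∫ ω, (X i ω : ℂ) * Complex.exp (((t * W ω : ℝ) : ℂ) * Complex.I) ∂μ)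
      - (t * Complex.I) * ∑ j ∈ s with R i j, ∫ ω, ((X i ω * X j ω : ℝ) : ℂ) *
          Complex.exp (((t * W ω : ℝ) : ℂ) * Complex.I) ∂μ
      = ∫ ω, -((X i ω : ℂ) * Complex.exp (((t * W ω : ℝ) : ℂ) * Complex.I) *
        (Complex.exp (((-(t * Z ω) : ℝ) : ℂ) * Complex.I) - 1
          - ((-(t * Z ω) : ℝ) : ℂ) * Complex.I)) ∂μ := by
    rw [← sub_zero (∫ ω, (X i ω : ℂ) * Complex.exp (((t * W ω : ℝ) : ℂ) * Complex.I) ∂μ), ← hf,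
      ← integral_finsetSum _ (fun _ _ => Integrable.of_finite), ← integral_const_mul,
      ← integral_sub Integrable.of_finite Integrable.of_finite,
      ← integral_sub Integrable.of_finite Integrable.of_finite]
    congr 1
    ext ω
    have e1 : Complex.exp (((t * V ω : ℝ) : ℂ) * Complex.I)
        = Complex.exp (((t * W ω : ℝ) : ℂ) * Complex.I) *
          Complex.exp (((-(t * Z ω) : ℝ) : ℂ) * Complex.I) := by
      rw [← Complex.exp_add]; congr 1; rw [hsum]; push_cast; ring
    have e2 : ∑ j ∈ s with R i j, ((X i ω * X j ω : ℝ) : ℂ) *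
          Complex.exp (((t * W ω : ℝ) : ℂ) * Complex.I)
        = (X i ω : ℂ) * (Z ω : ℂ) * Complex.exp (((t * W ω : ℝ) : ℂ) * Complex.I) := by
      rw [← Finset.sum_mul]; congr 1
      simp only [hZ]; push_cast; rw [Finset.mul_sum]
    rw [e2, e1]; push_cast; ring
  rw [hrew]
  calc _ ≤ ∫ ω, 2 * t ^ 2 * ∑ j ∈ s with R i j, ∑ k ∈ s with R i k, |X i ω * X j ω * X k ω| ∂μ := by
        refine norm_integral_le_of_norm_le Integrable.of_finite (ae_of_all _ fun ω => ?_)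
        rw [norm_neg, norm_mul, norm_mul, Complex.norm_exp_ofReal_mul_I, mul_one,
          Complex.norm_real, Real.norm_eq_abs]
        have h2 : (Z ω) ^ 2 ≤ (∑ j ∈ s with R i j, |X j ω|) ^ 2 := by
          rw [← sq_abs (Z ω)]
          gcongr
          exact Finset.abs_sum_le_sum_abs _ _
        calc _ ≤ |X i ω| * (2 * (-(t * Z ω)) ^ 2) := by gcongr; exact exp2_bound _
          _ = 2 * t ^ 2 * (|X i ω| * (Z ω) ^ 2) := by ring
          _ ≤ 2 * t ^ 2 * (|X i ω| * (∑ j ∈ s with R i j, |X j ω|) ^ 2) := by gcongr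
          _ = _ := by
            congr 1
            rw [sq, Finset.sum_mul_sum, Finset.mul_sum]
            refine Finset.sum_congr rfl fun j _ => ?_
            rw [Finset.mul_sum]
            refine Finset.sum_congr rfl fun k _ => ?_
            rw [abs_mul, abs_mul]; ring
    _ = _ := by
        rw [integral_const_mul, integral_finsetSum _ (fun _ _ => Integrable.of_finite)]
        congr 1
        refine Finset.sum_congr rfl fun j _ => ?_
        rw [integral_finsetSum _ (fun _ _ => Integrable.of_finite)]

lemma tikh_term2 {ι : Type*} (μ : Measure Ω) [IsProbabilityMeasure μ]
    (s : Finset ι) (R : ι → ι → Prop) (X : ι → Ω → ℝ) (i j : ι)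
    (hind : IndepFun (fun ω => X i ω * X j ω)
      (fun ω => ∑ k ∈ s with ¬ (R i k ∨ R j k), X k ω) μ) (t : ℝ) :
    ‖(∫ ω, ((X i ω * X j ω : ℝ) : ℂ) *
          Complex.exp (((t * ∑ j ∈ s, X j ω : ℝ) : ℂ) * Complex.I) ∂μ)
      - ((∫ ω, X i ω * X j ω ∂μ : ℝ) : ℂ) * cf μ (fun ω => ∑ j ∈ s, X j ω) t‖
      ≤ |t| * ∑ k ∈ s with R i k ∨ R j k, ((∫ ω, |X i ω * X j ω * X k ω| ∂μ) +
        (∫ ω, |X i ω * X j ω| ∂μ) * ∫ ω, |X k ω| ∂μ) := by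
  set W : Ω → ℝ := fun ω => ∑ j ∈ s, X j ω with hW
  set V : Ω → ℝ := fun ω => ∑ k ∈ s with ¬ (R i k ∨ R j k), X k ω with hV
  set Z : Ω → ℝ := fun ω => ∑ k ∈ s with (R i k ∨ R j k), X k ω with hZ
  have hsum : ∀ ω, W ω = Z ω + V ω := fun ω => by
    simp only [hW, hV, hZ]; rw [Finset.sum_filter_add_sum_filter_not]
  have hf := indep_factor μ _ V hind t
  have hexp : ∀ ω, ‖Complex.exp (((t * W ω : ℝ) : ℂ) * Complex.I) -
      Complex.exp (((t * V ω : ℝ) : ℂ) * Complex.I)‖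
        ≤ |t| * ∑ k ∈ s with (R i k ∨ R j k), |X k ω| := fun ω => by
    refine (exp1_bound _ _).trans ?_
    rw [hsum, ← mul_sub, add_sub_cancel_right, abs_mul]
    gcongr
    exact Finset.abs_sum_le_sum_abs _ _
  have hrew : (∫ ω, ((X i ω * X j ω : ℝ) : ℂ) *
          Complex.exp (((t * W ω : ℝ) : ℂ) * Complex.I) ∂μ)
      - ((∫ ω, X i ω * X j ω ∂μ : ℝ) : ℂ) * cf μ W t
      = (∫ ω, ((X i ω * X j ω : ℝ) : ℂ) * (Complex.exp (((t * W ω : ℝ) : ℂ) * Complex.I) -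
          Complex.exp (((t * V ω : ℝ) : ℂ) * Complex.I)) ∂μ)
        - ((∫ ω, X i ω * X j ω ∂μ : ℝ) : ℂ) *
          ∫ ω, (Complex.exp (((t * W ω : ℝ) : ℂ) * Complex.I) -
            Complex.exp (((t * V ω : ℝ) : ℂ) * Complex.I)) ∂μ := by
    simp only [mul_sub]
    rw [integral_sub Integrable.of_finite Integrable.of_finite,
      integral_sub Integrable.of_finite Integrable.of_finite, hf, mul_sub]
    simp only [cf]
    ring
  rw [hrew]
  refine (norm_sub_le _ _).trans ?_
  have b1 : ‖∫ ω, ((X i ω * X j ω : ℝ) : ℂ) * (Complex.exp (((t * W ω : ℝ) : ℂ) * Complex.I) -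
          Complex.exp (((t * V ω : ℝ) : ℂ) * Complex.I)) ∂μ‖
      ≤ |t| * ∑ k ∈ s with R i k ∨ R j k, ∫ ω, |X i ω * X j ω * X k ω| ∂μ := by
    rw [← integral_finsetSum _ (fun _ _ => Integrable.of_finite), ← integral_const_mul]
    refine norm_integral_le_of_norm_le Integrable.of_finite (ae_of_all _ fun ω => ?_)
    rw [norm_mul, Complex.norm_real, Real.norm_eq_abs]
    calc _ ≤ |X i ω * X j ω| * (|t| * ∑ k ∈ s with (R i k ∨ R j k), |X k ω|) := by
          gcongr; exact hexp ω
      _ = _ := by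
        rw [mul_left_comm, Finset.mul_sum]
        congr 1
        exact Finset.sum_congr rfl fun k _ => (abs_mul _ _).symm
  have b2 : ‖∫ ω, (Complex.exp (((t * W ω : ℝ) : ℂ) * Complex.I) -
            Complex.exp (((t * V ω : ℝ) : ℂ) * Complex.I)) ∂μ‖
      ≤ |t| * ∑ k ∈ s with R i k ∨ R j k, ∫ ω, |X k ω| ∂μ := by
    rw [← integral_finsetSum _ (fun _ _ => Integrable.of_finite), ← integral_const_mul]
    exact norm_integral_le_of_norm_le Integrable.of_finite (ae_of_all _ hexp)
  rw [Finset.sum_add_distrib, mul_add]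
  refine add_le_add b1 ?_
  rw [norm_mul, Complex.norm_real, ← Finset.mul_sum]
  calc _ ≤ (∫ ω, |X i ω * X j ω| ∂μ) * (|t| * ∑ k ∈ s with R i k ∨ R j k, ∫ ω, |X k ω| ∂μ) := by
        refine mul_le_mul (norm_integral_le_integral_norm _) b2 (norm_nonneg _)
          (integral_nonneg fun _ => abs_nonneg _)
    _ = _ := by ring

lemma tikh_deriv_bound {ι : Type*} (μ : Measure Ω) [IsProbabilityMeasure μ]
    (s : Finset ι) (R : ι → ι → Prop) (X : ι → Ω → ℝ)
    (h0 : ∀ i ∈ s, ∫ ω, X i ω ∂μ = 0)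
    (hind1 : ∀ i ∈ s, IndepFun (X i) (fun ω => ∑ j ∈ s with ¬ R i j, X j ω) μ)
    (hind2 : ∀ i ∈ s, ∀ j ∈ s, IndepFun (fun ω => X i ω * X j ω)
      (fun ω => ∑ k ∈ s with ¬ (R i k ∨ R j k), X k ω) μ)
    (hvar : ∑ i ∈ s, ∑ j ∈ s with R i j, ∫ ω, X i ω * X j ω ∂μ = 1) (t : ℝ) :
    ‖(∫ ω, ((∑ j ∈ s, X j ω : ℝ) : ℂ) *
        Complex.exp (((t * ∑ j ∈ s, X j ω : ℝ) : ℂ) * Complex.I) ∂μ)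
      - (t * Complex.I) * cf μ (fun ω => ∑ j ∈ s, X j ω) t‖ ≤ 3 * t ^ 2 * tripleErr μ s R X := by
  set E : Ω → ℂ := fun ω => Complex.exp (((t * ∑ j ∈ s, X j ω : ℝ) : ℂ) * Complex.I) with hE
  set φ := cf μ (fun ω => ∑ j ∈ s, X j ω) t
  have hφ : φ = ∑ i ∈ s, ∑ j ∈ s with R i j, ((∫ ω, X i ω * X j ω ∂μ : ℝ) : ℂ) * φ := by
    simp only [← Finset.sum_mul]
    rw [← one_mul φ, ← mul_assoc]
    congr 1
    rw [mul_one]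
    exact_mod_cast hvar.symm
  have hd : (∫ ω, ((∑ j ∈ s, X j ω : ℝ) : ℂ) * E ω ∂μ) - (t * Complex.I) * φ
      = (∑ i ∈ s, ((∫ ω, (X i ω : ℂ) * E ω ∂μ) -
          (t * Complex.I) * ∑ j ∈ s with R i j, ∫ ω, ((X i ω * X j ω : ℝ) : ℂ) * E ω ∂μ))
        + (t * Complex.I) * ∑ i ∈ s, ∑ j ∈ s with R i j,
          ((∫ ω, ((X i ω * X j ω : ℝ) : ℂ) * E ω ∂μ) - ((∫ ω, X i ω * X j ω ∂μ : ℝ) : ℂ) * φ) := by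
    have : (∫ ω, ((∑ j ∈ s, X j ω : ℝ) : ℂ) * E ω ∂μ) = ∑ i ∈ s, ∫ ω, (X i ω : ℂ) * E ω ∂μ := by
      rw [← integral_finsetSum _ (fun _ _ => Integrable.of_finite)]
      congr 1; ext ω; push_cast; rw [Finset.sum_mul]
    rw [this]
    simp only [Finset.sum_sub_distrib]
    rw [← hφ, ← Finset.mul_sum]
    ring
  rw [hd]
  have hT1 : ∑ i ∈ s, ∑ j ∈ s with R i j, ∑ k ∈ s with R i k, ∫ ω, |X i ω * X j ω * X k ω| ∂μ
      ≤ tripleErr μ s R X := by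
    refine Finset.sum_le_sum fun i _ => Finset.sum_le_sum fun j _ => ?_
    refine (Finset.sum_le_sum_of_subset_of_nonneg (t := s.filter fun k => R i k ∨ R j k) ?_
      (fun _ _ _ => integral_nonneg fun _ => abs_nonneg _)).trans ?_
    · intro k hk
      simp only [Finset.mem_filter] at hk ⊢
      exact ⟨hk.1, Or.inl hk.2⟩
    · refine Finset.sum_le_sum fun k _ => ?_
      exact le_add_of_nonneg_right (mul_nonneg (integral_nonneg fun _ => abs_nonneg _)
        (integral_nonneg fun _ => abs_nonneg _))
  refine (norm_add_le _ _).trans ?_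
  have c1 : ‖∑ i ∈ s, ((∫ ω, (X i ω : ℂ) * E ω ∂μ) -
          (t * Complex.I) * ∑ j ∈ s with R i j, ∫ ω, ((X i ω * X j ω : ℝ) : ℂ) * E ω ∂μ)‖
        ≤ 2 * t ^ 2 * tripleErr μ s R X := by
    refine (norm_sum_le _ _).trans ?_
    refine le_trans ?_ (mul_le_mul_of_nonneg_left hT1 (by positivity))
    rw [Finset.mul_sum]
    exact Finset.sum_le_sum fun i hi => tikh_term1 μ s R X i (h0 i hi) (hind1 i hi) t
  have c2 : ‖(t * Complex.I) * ∑ i ∈ s, ∑ j ∈ s with R i j,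
          ((∫ ω, ((X i ω * X j ω : ℝ) : ℂ) * E ω ∂μ) - ((∫ ω, X i ω * X j ω ∂μ : ℝ) : ℂ) * φ)‖
        ≤ |t| * (|t| * tripleErr μ s R X) := by
    rw [norm_mul]
    have : ‖(t * Complex.I : ℂ)‖ = |t| := by simp
    rw [this]
    gcongr
    refine (norm_sum_le _ _).trans ?_
    rw [tripleErr, Finset.mul_sum]
    refine Finset.sum_le_sum fun i hi => ?_
    refine (norm_sum_le _ _).trans ?_
    rw [Finset.mul_sum]
    refine Finset.sum_le_sum fun j hj => ?_
    exact tikh_term2 μ s R X i j (hind2 i hi j (Finset.mem_filter.1 hj).1) t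
  refine (add_le_add c1 c2).trans (le_of_eq ?_)
  rw [← mul_assoc, abs_mul_abs_self]; ring

lemma cf_hasDerivAt (μ : Measure Ω) [IsProbabilityMeasure μ] (W : Ω → ℝ) (t : ℝ) :
    HasDerivAt (cf μ W) (Complex.I * ∫ ω, (W ω : ℂ) *
      Complex.exp (((t * W ω : ℝ) : ℂ) * Complex.I) ∂μ) t := by
  have := Fintype.ofFinite Ω
  have h : ∀ g : Ω → ℂ, ∫ ω, g ω ∂μ = ∑ ω, μ.real {ω} • g ω := fun g => by
    rw [integral_fintype Integrable.of_finite]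
  have h2 : cf μ W = fun t => ∑ ω, μ.real {ω} • Complex.exp (((t * W ω : ℝ) : ℂ) * Complex.I) := by
    ext t; rw [cf, h]
  rw [h2, h, Finset.mul_sum]
  refine HasDerivAt.fun_sum fun ω _ => ?_
  have e : HasDerivAt (fun t : ℝ => Complex.exp (((t * W ω : ℝ) : ℂ) * Complex.I))
      (Complex.exp (((t * W ω : ℝ) : ℂ) * Complex.I) * ((W ω : ℂ) * Complex.I)) t := by
    refine HasDerivAt.cexp ?_
    refine HasDerivAt.mul_const ?_ _
    have := ((hasDerivAt_id t).mul_const (W ω)).ofReal_comp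
    simpa using this
  refine (e.const_smul (μ.real {ω})).congr_deriv ?_
  simp only [Complex.real_smul]
  ring

theorem tikhomirov {ι : Type*} (μ : Measure Ω) [IsProbabilityMeasure μ]
    (s : Finset ι) (R : ι → ι → Prop) (X : ι → Ω → ℝ)
    (h0 : ∀ i ∈ s, ∫ ω, X i ω ∂μ = 0)
    (hind1 : ∀ i ∈ s, IndepFun (X i) (fun ω => ∑ j ∈ s with ¬ R i j, X j ω) μ)
    (hind2 : ∀ i ∈ s, ∀ j ∈ s, IndepFun (fun ω => X i ω * X j ω)
      (fun ω => ∑ k ∈ s with ¬ (R i k ∨ R j k), X k ω) μ)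
    (hvar : ∑ i ∈ s, ∑ j ∈ s with R i j, ∫ ω, X i ω * X j ω ∂μ = 1) (t : ℝ) :
    ‖cf μ (fun ω => ∑ j ∈ s, X j ω) t - Complex.exp (-(t ^ 2 / 2 : ℝ))‖
      ≤ 3 * |t| ^ 3 * Real.exp (t ^ 2 / 2) * tripleErr μ s R X := by
  set φ := cf μ (fun ω => ∑ j ∈ s, X j ω) with hφ
  set T := tripleErr μ s R X with hT
  have hT0 : 0 ≤ T := by
    refine Finset.sum_nonneg fun i _ => Finset.sum_nonneg fun j _ => Finset.sum_nonneg fun k _ => ?_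
    exact add_nonneg (integral_nonneg fun _ => abs_nonneg _)
      (mul_nonneg (integral_nonneg fun _ => abs_nonneg _) (integral_nonneg fun _ => abs_nonneg _))
  let g : ℝ → ℂ := fun u => φ u * Complex.exp ((u ^ 2 / 2 : ℝ))
  have hderiv : ∀ u, HasDerivAt g ((Complex.I * (∫ ω, ((∑ j ∈ s, X j ω : ℝ) : ℂ) *
      Complex.exp (((u * ∑ j ∈ s, X j ω : ℝ) : ℂ) * Complex.I) ∂μ)) * Complex.exp ((u ^ 2 / 2 : ℝ))
      + φ u * (Complex.exp ((u ^ 2 / 2 : ℝ)) * u)) u := by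
    intro u
    refine (cf_hasDerivAt μ _ u).mul ?_
    refine HasDerivAt.cexp ?_
    have h1 : HasDerivAt (fun u : ℝ => u ^ 2 / 2) u u := by
      have := ((hasDerivAt_id u).pow 2).div_const 2
      simpa using this
    exact h1.ofReal_comp
  have hbd : ∀ u ∈ Set.uIcc 0 t, ‖(Complex.I * (∫ ω, ((∑ j ∈ s, X j ω : ℝ) : ℂ) *
      Complex.exp (((u * ∑ j ∈ s, X j ω : ℝ) : ℂ) * Complex.I) ∂μ)) * Complex.exp ((u ^ 2 / 2 : ℝ))
      + φ u * (Complex.exp ((u ^ 2 / 2 : ℝ)) * u)‖ ≤ 3 * t ^ 2 * T * Real.exp (t ^ 2 / 2) := by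
    intro u hu
    have hut : u ^ 2 ≤ t ^ 2 := by
      rcases Set.mem_uIcc.1 hu with h | h
      · nlinarith
      · nlinarith
    have e : (Complex.I * (∫ ω, ((∑ j ∈ s, X j ω : ℝ) : ℂ) *
      Complex.exp (((u * ∑ j ∈ s, X j ω : ℝ) : ℂ) * Complex.I) ∂μ)) * Complex.exp ((u ^ 2 / 2 : ℝ))
      + φ u * (Complex.exp ((u ^ 2 / 2 : ℝ)) * u)
      = Complex.I * ((∫ ω, ((∑ j ∈ s, X j ω : ℝ) : ℂ) *
      Complex.exp (((u * ∑ j ∈ s, X j ω : ℝ) : ℂ) * Complex.I) ∂μ) - (u * Complex.I) * φ u) *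
        Complex.exp ((u ^ 2 / 2 : ℝ)) := by
      have : Complex.I * Complex.I = -1 := Complex.I_mul_I
      linear_combination (φ u * u * Complex.exp ((u ^ 2 / 2 : ℝ))) * this
    rw [e, norm_mul, norm_mul, Complex.norm_I, one_mul, ← Complex.ofReal_exp, Complex.norm_real,
      Real.norm_eq_abs, Real.abs_exp]
    have := tikh_deriv_bound μ s R X h0 hind1 hind2 hvar u
    calc _ ≤ 3 * u ^ 2 * T * Real.exp (u ^ 2 / 2) := by gcongr
      _ ≤ _ := by gcongr
  have hmv := (convex_uIcc 0 t).norm_image_sub_le_of_norm_hasDerivWithin_le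
    (fun u _ => (hderiv u).hasDerivWithinAt) hbd Set.left_mem_uIcc Set.right_mem_uIcc
  have hg0 : g 0 = 1 := by
    simp [g, hφ, cf]
  rw [hg0] at hmv
  have hfin : φ t - Complex.exp (-(t ^ 2 / 2 : ℝ)) = (g t - 1) * Complex.exp (-(t ^ 2 / 2 : ℝ)) := by
    simp only [g]
    rw [sub_mul, mul_assoc, ← Complex.exp_add, one_mul]
    simp
  rw [hfin, norm_mul]
  have : ‖Complex.exp (-(t ^ 2 / 2 : ℝ))‖ ≤ 1 := by
    rw [← Complex.ofReal_neg, ← Complex.ofReal_exp, Complex.norm_real, Real.norm_eq_abs, Real.abs_exp]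
    exact Real.exp_le_one_iff.2 (by nlinarith [sq_nonneg t])
  calc _ ≤ (3 * t ^ 2 * T * Real.exp (t ^ 2 / 2) * ‖t - 0‖) * 1 := by gcongr
    _ = _ := by rw [sub_zero, Real.norm_eq_abs, ← sq_abs t]; ring

end Tikhomirov

section Bern

variable {n : ℕ}

instance bern_prob (p : ℝ≥0) (h : p ≤ 1) : IsProbabilityMeasure (bern p h) := by
  unfold bern; infer_instance

instance prodBern_prob (n : ℕ) (p : ℝ≥0) (h : p ≤ 1) : IsProbabilityMeasure (prodBern n p h) := by
  unfold prodBern; infer_instance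

/-- Indicator that all elements of `S` are selected. -/
noncomputable def indS (S : Finset (Fin n)) (ω : Fin n → Bool) : ℝ :=
  if ∀ i ∈ S, ω i = true then 1 else 0

lemma indS_mul (S T : Finset (Fin n)) (ω : Fin n → Bool) :
    indS S ω * indS T ω = indS (S ∪ T) ω := by
  unfold indS
  by_cases h1 : ∀ i ∈ S, ω i = true
  · by_cases h2 : ∀ i ∈ T, ω i = true
    · have h3 : ∀ i ∈ S ∪ T, ω i = true := fun i hi =>
        (Finset.mem_union.1 hi).elim (h1 i) (h2 i)
      rw [if_pos h1, if_pos h2, if_pos h3, mul_one]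
    · have h3 : ¬ ∀ i ∈ S ∪ T, ω i = true := fun h =>
        h2 fun i hi => h i (Finset.mem_union_right _ hi)
      rw [if_neg h2, if_neg h3, mul_zero]
  · have h3 : ¬ ∀ i ∈ S ∪ T, ω i = true := fun h =>
      h1 fun i hi => h i (Finset.mem_union_left _ hi)
    rw [if_neg h1, if_neg h3, zero_mul]

lemma indS_nonneg (S : Finset (Fin n)) (ω : Fin n → Bool) : 0 ≤ indS S ω := by
  unfold indS; split_ifs <;> norm_num

lemma indS_le_one (S : Finset (Fin n)) (ω : Fin n → Bool) : indS S ω ≤ 1 := by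
  unfold indS; split_ifs <;> norm_num

lemma integral_indS (p : ℝ≥0) (h : p ≤ 1) (S : Finset (Fin n)) :
    ∫ ω, indS S ω ∂(prodBern n p h) = (p : ℝ) ^ S.card := by
  have e : ∀ ω : Fin n → Bool, indS S ω
      = ∏ i, (if i ∈ S then (if ω i = true then (1 : ℝ) else 0) else 1) := by
    intro ω
    unfold indS
    rw [Finset.prod_ite_mem, Finset.univ_inter, Finset.prod_ite_zero]
    simp
  simp_rw [e, prodBern]
  rw [integral_fintype_prod_eq_prod (f := fun i b => if i ∈ S then (if b = true then (1 : ℝ) else 0) else 1)]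
  have : ∀ i, (∫ b, (if i ∈ S then (if b = true then (1 : ℝ) else 0) else 1) ∂(bern p h))
      = if i ∈ S then (p : ℝ) else 1 := by
    intro i
    split_ifs with hi
    · unfold bern
      rw [PMF.integral_eq_sum]
      simp [PMF.bernoulli_apply]
    · rw [integral_const]; simp only [probReal_univ, smul_eq_mul, mul_one]
  simp_rw [this]
  rw [Finset.prod_ite_mem, Finset.univ_inter, Finset.prod_const]

lemma indep_of_disjoint (p : ℝ≥0) (h : p ≤ 1) (S T : Finset (Fin n)) (hST : Disjoint S T)
    (F G : (Fin n → Bool) → ℝ) (hF : ∀ ω ω', (∀ i ∈ S, ω i = ω' i) → F ω = F ω')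
    (hG : ∀ ω ω', (∀ i ∈ T, ω i = ω' i) → G ω = G ω') : IndepFun F G (prodBern n p h) := by
  have hi : iIndepFun (fun (i : Fin n) (ω : Fin n → Bool) => ω i) (prodBern n p h) := by
    exact iIndepFun_pi (X := fun _ b => b) (μ := fun _ : Fin n => bern p h)
      (fun _ => measurable_id.aemeasurable)
  have h2 := hi.indepFun_finset S T hST (fun i => measurable_pi_apply i)
  have h3 := h2.comp (φ := fun u : S → Bool => F fun i => if hi : i ∈ S then u ⟨i, hi⟩ else false)
    (ψ := fun u : T → Bool => G fun i => if hi : i ∈ T then u ⟨i, hi⟩ else false)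
    Measurable.of_discrete Measurable.of_discrete
  convert h3 using 1
  · ext ω
    refine hF _ _ fun i hi => ?_
    simp [hi]
  · ext ω
    refine hG _ _ fun i hi => ?_
    simp [hi]

lemma indS_congr (S : Finset (Fin n)) (ω ω' : Fin n → Bool) (h : ∀ i ∈ S, ω i = ω' i) :
    indS S ω = indS S ω' := by
  unfold indS
  congr 1
  exact propext ⟨fun H i hi => by rw [← h i hi]; exact H i hi,
    fun H i hi => by rw [h i hi]; exact H i hi⟩

variable (p : ℝ≥0) (h : p ≤ 1)

/-- The centered indicator. -/
noncomputable def cInd (m : ℕ) (p : ℝ≥0) (S : Finset (Fin n)) (ω : Fin n → Bool) : ℝ :=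
  indS S ω - (p : ℝ) ^ m

lemma integral_cInd {m : ℕ} (S : Finset (Fin n)) (hS : S.card = m) :
    ∫ ω, cInd m p S ω ∂(prodBern n p h) = 0 := by
  unfold cInd
  rw [integral_sub Integrable.of_finite Integrable.of_finite, integral_indS, hS]
  simp

lemma integral_cInd_mul {m : ℕ} (S T : Finset (Fin n)) (hS : S.card = m) (hT : T.card = m) :
    ∫ ω, cInd m p S ω * cInd m p T ω ∂(prodBern n p h)
      = (p : ℝ) ^ (S ∪ T).card - (p : ℝ) ^ (2 * m) := by
  have : ∀ ω, cInd m p S ω * cInd m p T ω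
      = indS (S ∪ T) ω - (p : ℝ) ^ m * indS S ω - (p : ℝ) ^ m * indS T ω + (p : ℝ) ^ (2 * m) := by
    intro ω
    rw [← indS_mul]; unfold cInd; ring
  simp_rw [this]
  rw [integral_add Integrable.of_finite Integrable.of_finite,
    integral_sub Integrable.of_finite Integrable.of_finite,
    integral_sub Integrable.of_finite Integrable.of_finite, integral_const_mul, integral_const_mul,
    integral_indS, integral_indS, integral_indS, hS, hT]
  simp; ring

lemma abs_cInd_le {m : ℕ} (S : Finset (Fin n)) (ω : Fin n → Bool) :
    |cInd m p S ω| ≤ indS S ω + (p : ℝ) ^ m := by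
  have := indS_nonneg S ω
  have h2 : (0 : ℝ) ≤ (p : ℝ) ^ m := by positivity
  rw [abs_le]; unfold cInd; constructor <;> linarith

lemma abs_cInd_le_one (p : ℝ≥0) (h : p ≤ 1) {m : ℕ} (S : Finset (Fin n)) (ω : Fin n → Bool) :
    |cInd m p S ω| ≤ 1 := by
  have := indS_nonneg S ω
  have := indS_le_one S ω
  have h2 : (0 : ℝ) ≤ (p : ℝ) ^ m := by positivity
  have h3 : (p : ℝ) ^ m ≤ 1 := pow_le_one₀ p.2 (by exact_mod_cast h)
  rw [abs_le]; unfold cInd; constructor <;> linarith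

lemma integral_abs_cInd_le {m : ℕ} (S : Finset (Fin n)) (hS : S.card = m) :
    ∫ ω, |cInd m p S ω| ∂(prodBern n p h) ≤ 2 * m * (1 - p) := by
  have hb : (1 : ℝ) - (p : ℝ) ^ m ≤ m * (1 - p) := by
    have := one_add_mul_le_pow (a := (p : ℝ) - 1) (by have := p.2; simp at *; linarith) m
    simp at this; linarith
  have h3 : (p : ℝ) ^ m ≤ 1 := pow_le_one₀ p.2 (by exact_mod_cast h)
  calc _ ≤ ∫ ω, ((1 - indS S ω) + (1 - (p : ℝ) ^ m)) ∂(prodBern n p h) := by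
        refine integral_mono Integrable.of_finite Integrable.of_finite fun ω => ?_
        have := indS_le_one S ω
        simp only
        rw [abs_le]; unfold cInd; constructor <;> linarith
    _ = 2 * (1 - (p : ℝ) ^ m) := by
        rw [integral_add Integrable.of_finite Integrable.of_finite,
          integral_sub Integrable.of_finite Integrable.of_finite, integral_indS, hS]
        simp; ring
    _ ≤ _ := by linarith

lemma pow_union_le (h : p ≤ 1) {a b : ℕ} (hab : b ≤ a) : (p : ℝ) ^ a ≤ (p : ℝ) ^ b :=
  pow_le_pow_of_le_one p.2 (by exact_mod_cast h) hab

lemma moment3_small {m : ℕ} (S T U : Finset (Fin n)) (hS : S.card = m) (hT : T.card = m)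
    (hU : U.card = m) :
    ∫ ω, |cInd m p S ω * cInd m p T ω * cInd m p U ω| ∂(prodBern n p h)
      ≤ 8 * (p : ℝ) ^ (S ∪ T ∪ U).card := by
  have key : ∀ ω, |cInd m p S ω * cInd m p T ω * cInd m p U ω|
      ≤ indS (S ∪ T ∪ U) ω + (p : ℝ) ^ m * indS (S ∪ T) ω + (p : ℝ) ^ m * indS (S ∪ U) ω +
        (p : ℝ) ^ m * indS (T ∪ U) ω + (p : ℝ) ^ (2 * m) * indS S ω + (p : ℝ) ^ (2 * m) * indS T ω
        + (p : ℝ) ^ (2 * m) * indS U ω + (p : ℝ) ^ (3 * m) := by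
    intro ω
    rw [abs_mul, abs_mul]
    have := indS_nonneg S ω
    have := indS_nonneg T ω
    have := indS_nonneg U ω
    calc _ ≤ (indS S ω + (p : ℝ) ^ m) * (indS T ω + (p : ℝ) ^ m) * (indS U ω + (p : ℝ) ^ m) := by
          gcongr <;> exact abs_cInd_le p _ ω
      _ = _ := by
        rw [← indS_mul, ← indS_mul, ← indS_mul, ← indS_mul]; ring
  have c1 : (S ∪ T).card ≤ S.card + T.card := Finset.card_union_le _ _
  have c2 : (S ∪ U).card ≤ S.card + U.card := Finset.card_union_le _ _
  have c3 : (T ∪ U).card ≤ T.card + U.card := Finset.card_union_le _ _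
  have d1 : (S ∪ T ∪ U).card ≤ (S ∪ T).card + U.card := Finset.card_union_le _ _
  have d2 : (S ∪ T ∪ U).card ≤ (S ∪ U).card + T.card := by
    rw [Finset.union_right_comm]; exact Finset.card_union_le _ _
  have d3 : (S ∪ T ∪ U).card ≤ (T ∪ U).card + S.card := by
    rw [Finset.union_assoc, Finset.union_comm]; exact Finset.card_union_le _ _
  refine (integral_mono Integrable.of_finite Integrable.of_finite key).trans ?_
  rw [integral_add Integrable.of_finite Integrable.of_finite,
    integral_add Integrable.of_finite Integrable.of_finite,
    integral_add Integrable.of_finite Integrable.of_finite,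
    integral_add Integrable.of_finite Integrable.of_finite,
    integral_add Integrable.of_finite Integrable.of_finite,
    integral_add Integrable.of_finite Integrable.of_finite,
    integral_add Integrable.of_finite Integrable.of_finite]
  simp only [integral_const_mul, integral_indS, integral_const, probReal_univ, one_smul, hS, hT, hU,
    ← pow_add]
  have e1 := pow_union_le p h (a := m + (S ∪ T).card) (b := (S ∪ T ∪ U).card) (by omega)
  have e2 := pow_union_le p h (a := m + (S ∪ U).card) (b := (S ∪ T ∪ U).card) (by omega)
  have e3 := pow_union_le p h (a := m + (T ∪ U).card) (b := (S ∪ T ∪ U).card) (by omega)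
  have e4 := pow_union_le p h (a := 2 * m + m) (b := (S ∪ T ∪ U).card) (by omega)
  have e5 := pow_union_le p h (a := 3 * m) (b := (S ∪ T ∪ U).card) (by omega)
  linarith

lemma moment2_small {m : ℕ} (S T : Finset (Fin n)) (hS : S.card = m) (hT : T.card = m) :
    ∫ ω, |cInd m p S ω * cInd m p T ω| ∂(prodBern n p h) ≤ 4 * (p : ℝ) ^ (S ∪ T).card := by
  have key : ∀ ω, |cInd m p S ω * cInd m p T ω|
      ≤ indS (S ∪ T) ω + (p : ℝ) ^ m * indS S ω + (p : ℝ) ^ m * indS T ω + (p : ℝ) ^ (2 * m) := by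
    intro ω
    rw [abs_mul]
    have := indS_nonneg S ω
    have := indS_nonneg T ω
    calc _ ≤ (indS S ω + (p : ℝ) ^ m) * (indS T ω + (p : ℝ) ^ m) := by
          gcongr <;> exact abs_cInd_le p _ ω
      _ = _ := by rw [← indS_mul]; ring
  have c1 : (S ∪ T).card ≤ S.card + T.card := Finset.card_union_le _ _
  refine (integral_mono Integrable.of_finite Integrable.of_finite key).trans ?_
  rw [integral_add Integrable.of_finite Integrable.of_finite,
    integral_add Integrable.of_finite Integrable.of_finite,
    integral_add Integrable.of_finite Integrable.of_finite]
  simp only [integral_const_mul, integral_indS, integral_const, probReal_univ, one_smul, hS, hT,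
    ← pow_add]
  have e1 := pow_union_le p h (a := m + m) (b := (S ∪ T).card) (by omega)
  have e2 := pow_union_le p h (a := 2 * m) (b := (S ∪ T).card) (by omega)
  linarith

lemma moment1_small {m : ℕ} (S : Finset (Fin n)) (hS : S.card = m) :
    ∫ ω, |cInd m p S ω| ∂(prodBern n p h) ≤ 2 * (p : ℝ) ^ m := by
  refine (integral_mono Integrable.of_finite Integrable.of_finite
    (fun ω => abs_cInd_le (m := m) p S ω)).trans ?_
  rw [integral_add Integrable.of_finite Integrable.of_finite, integral_indS, hS]
  simp; linarith

/-- The constant in the third moment bound. -/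
noncomputable def momC (m : ℕ) : ℝ := 16 + 2 * m * 2 ^ (3 * m)

lemma moment_combine (p : ℝ≥0) (h : p ≤ 1) {m k : ℕ} (hk : k ≤ 3 * m) (a : ℝ) (h1 : a ≤ 8 * (p : ℝ) ^ k)
    (h2 : a ≤ 2 * m * (1 - p)) : a ≤ momC m * ((1 - p) * (p : ℝ) ^ k) := by
  have hp0 : (0 : ℝ) ≤ p := p.2
  have hp1 : (p : ℝ) ≤ 1 := by exact_mod_cast h
  have hpk : (0 : ℝ) ≤ (p : ℝ) ^ k := by positivity
  unfold momC
  by_cases hp : (p : ℝ) ≤ 1 / 2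
  · have : (0 : ℝ) ≤ 2 * m * 2 ^ (3 * m) * ((1 - p) * (p : ℝ) ^ k) := by
      have : (0 : ℝ) ≤ 1 - p := by linarith
      positivity
    nlinarith
  · push Not at hp
    have h3 : (1 : ℝ) ≤ 2 ^ (3 * m) * (p : ℝ) ^ k := by
      calc (1 : ℝ) ≤ (2 * p) ^ (3 * m) := one_le_pow₀ (by linarith)
        _ = 2 ^ (3 * m) * (p : ℝ) ^ (3 * m) := mul_pow _ _ _
        _ ≤ _ := by gcongr ?_ * ?_; exact pow_union_le p h hk
    have h4 : (0 : ℝ) ≤ 2 * m * (1 - p) := by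
      have : (0 : ℝ) ≤ 1 - p := by linarith
      positivity
    have h5 : (0 : ℝ) ≤ (1 - p) * (p : ℝ) ^ k := mul_nonneg (by linarith) hpk
    calc a ≤ 2 * m * (1 - p) * 1 := by linarith
      _ ≤ 2 * m * (1 - p) * (2 ^ (3 * m) * (p : ℝ) ^ k) := by gcongr
      _ ≤ _ := by nlinarith

lemma moment_bound {m : ℕ} (S T U : Finset (Fin n)) (hS : S.card = m) (hT : T.card = m)
    (hU : U.card = m) :
    (∫ ω, |cInd m p S ω * cInd m p T ω * cInd m p U ω| ∂(prodBern n p h)) +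
      (∫ ω, |cInd m p S ω * cInd m p T ω| ∂(prodBern n p h)) *
        ∫ ω, |cInd m p U ω| ∂(prodBern n p h)
      ≤ 2 * momC m * ((1 - p) * (p : ℝ) ^ (S ∪ T ∪ U).card) := by
  have c1 : (S ∪ T).card ≤ S.card + T.card := Finset.card_union_le _ _
  have d1 : (S ∪ T ∪ U).card ≤ (S ∪ T).card + U.card := Finset.card_union_le _ _
  have hk : (S ∪ T ∪ U).card ≤ 3 * m := by omega
  have a1 := moment_combine p h hk _ (moment3_small p h S T U hS hT hU) (by
    refine le_trans ?_ (integral_abs_cInd_le p h S hS)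
    refine integral_mono Integrable.of_finite Integrable.of_finite fun ω => ?_
    simp only [abs_mul]
    have := abs_cInd_le_one p h (m := m) T ω
    have := abs_cInd_le_one p h (m := m) U ω
    calc _ ≤ |cInd m p S ω| * 1 * 1 := by gcongr
      _ = _ := by ring)
  have i2 : 0 ≤ ∫ ω, |cInd m p U ω| ∂(prodBern n p h) := integral_nonneg fun _ => abs_nonneg _
  have i1 : 0 ≤ ∫ ω, |cInd m p S ω * cInd m p T ω| ∂(prodBern n p h) :=
    integral_nonneg fun _ => abs_nonneg _
  have a2 := moment_combine p h hk (a := (∫ ω, |cInd m p S ω * cInd m p T ω| ∂(prodBern n p h)) *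
        ∫ ω, |cInd m p U ω| ∂(prodBern n p h)) (by
    calc _ ≤ (4 * (p : ℝ) ^ (S ∪ T).card) * (2 * (p : ℝ) ^ m) := by
          gcongr
          · exact moment2_small p h S T hS hT
          · exact moment1_small p h U hU
      _ = 8 * (p : ℝ) ^ ((S ∪ T).card + m) := by rw [pow_add]; ring
      _ ≤ _ := by gcongr ?_ * ?_; exact pow_union_le p h (by omega)) (by
    refine le_trans ?_ (integral_abs_cInd_le p h U hU)
    refine mul_le_of_le_one_left i2 ?_
    have : ∫ ω : Fin n → Bool, (1 : ℝ) ∂(prodBern n p h) = 1 := by simp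
    rw [← this]
    refine integral_mono Integrable.of_finite Integrable.of_finite fun ω => ?_
    simp only [abs_mul]
    have := abs_cInd_le_one p h (m := m) T ω
    have := abs_cInd_le_one p h (m := m) S ω
    exact mul_le_one₀ this (abs_nonneg _) (by assumption))
  linarith

lemma cov_nonneg {m : ℕ} (S T : Finset (Fin n)) (hS : S.card = m) (hT : T.card = m) :
    0 ≤ ∫ ω, cInd m p S ω * cInd m p T ω ∂(prodBern n p h) := by
  rw [integral_cInd_mul p h S T hS hT]
  have c1 : (S ∪ T).card ≤ S.card + T.card := Finset.card_union_le _ _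
  have := pow_union_le p h (a := 2 * m) (b := (S ∪ T).card) (by omega)
  linarith

lemma cov_lower {m q : ℕ} (S T : Finset (Fin n)) (hS : S.card = m) (hT : T.card = m)
    (hq : 0 < q) (hc : q ≤ (S ∩ T).card) :
    (1 - p) * (p : ℝ) ^ (2 * m - q) ≤ ∫ ω, cInd m p S ω * cInd m p T ω ∂(prodBern n p h) := by
  rw [integral_cInd_mul p h S T hS hT]
  have c := Finset.card_union_add_card_inter S T
  have hp1 : (p : ℝ) ≤ 1 := by exact_mod_cast h
  have e : 2 * m = (S ∪ T).card + (S ∩ T).card := by omega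
  have e2 : (p : ℝ) ^ (2 * m) = (p : ℝ) ^ (S ∪ T).card * (p : ℝ) ^ (S ∩ T).card := by
    rw [e, pow_add]
  rw [e2]
  have h1 := pow_union_le p h (a := 2 * m - q) (b := (S ∪ T).card) (by omega)
  have h2 := pow_union_le p h (a := (S ∩ T).card) (b := 1) (by omega)
  rw [pow_one] at h2
  have h3 : (0 : ℝ) ≤ (p : ℝ) ^ (S ∪ T).card := by positivity
  nlinarith

/-- The sum of covariances. -/
noncomputable def covSum {ι : Type*} (m : ℕ) (s : Finset ι) (S : ι → Finset (Fin n)) : ℝ :=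
  ∑ i ∈ s, ∑ j ∈ s, ∫ ω, cInd m p (S i) ω * cInd m p (S j) ω ∂(prodBern n p h)

/-- The relation of sharing an element. -/
def shr {ι : Type*} (S : ι → Finset (Fin n)) (i j : ι) : Prop := ¬ Disjoint (S i) (S j)

/-- The triple union sum. -/
noncomputable def tripSum {ι : Type*} (p : ℝ≥0) (s : Finset ι) (S : ι → Finset (Fin n)) : ℝ :=
  ∑ i ∈ s, ∑ j ∈ s with shr S i j,
    ∑ k ∈ s with (shr S i k ∨ shr S j k), (p : ℝ) ^ (S i ∪ S j ∪ S k).card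

lemma sum_ind_mean {ι : Type*} {m : ℕ} (s : Finset ι) (S : ι → Finset (Fin n))
    (hS : ∀ i ∈ s, (S i).card = m) :
    ∫ ω, ∑ i ∈ s, indS (S i) ω ∂(prodBern n p h) = s.card * (p : ℝ) ^ m := by
  rw [integral_finsetSum _ (fun _ _ => Integrable.of_finite)]
  rw [Finset.sum_congr rfl (fun i hi => by rw [integral_indS, hS i hi])]
  simp

lemma sum_ind_variance {ι : Type*} {m : ℕ} (s : Finset ι) (S : ι → Finset (Fin n))
    (hS : ∀ i ∈ s, (S i).card = m) :
    variance (fun ω => ∑ i ∈ s, indS (S i) ω) (prodBern n p h) = covSum p h m s S := by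
  rw [variance_eq_integral Measurable.of_discrete.aemeasurable, sum_ind_mean p h s S hS]
  have : ∀ ω, (∑ i ∈ s, indS (S i) ω - s.card * (p : ℝ) ^ m) ^ 2
      = ∑ i ∈ s, ∑ j ∈ s, cInd m p (S i) ω * cInd m p (S j) ω := by
    intro ω
    rw [← Finset.sum_mul_sum, ← sq]
    congr 1
    simp [cInd, Finset.sum_sub_distrib]
  simp_rw [this]
  rw [integral_finsetSum _ (fun _ _ => Integrable.of_finite)]
  refine Finset.sum_congr rfl fun i _ => ?_
  rw [integral_finsetSum _ (fun _ _ => Integrable.of_finite)]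

theorem bern_clt_bound {ι : Type*} {m : ℕ} (s : Finset ι) (S : ι → Finset (Fin n))
    (hS : ∀ i ∈ s, (S i).card = m) (v : ℝ) (hv : v = covSum p h m s S) (hv0 : 0 < v) (t : ℝ) :
    ‖cf (prodBern n p h) (fun ω => (∑ i ∈ s, indS (S i) ω - s.card * (p : ℝ) ^ m) / √v) t
        - Complex.exp (-(t ^ 2 / 2 : ℝ))‖
      ≤ 3 * |t| ^ 3 * Real.exp (t ^ 2 / 2) *
        (2 * momC m * (1 - p) * tripSum p s S / (√v) ^ 3) := by
  set X : ι → (Fin n → Bool) → ℝ := fun i ω => cInd m p (S i) ω / √v with hX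
  have hsv : 0 < √v := Real.sqrt_pos.2 hv0
  have hW : (fun ω => (∑ i ∈ s, indS (S i) ω - s.card * (p : ℝ) ^ m) / √v)
      = fun ω => ∑ i ∈ s, X i ω := by
    ext ω
    simp only [hX]
    rw [← Finset.sum_div]
    congr 1
    simp [cInd, Finset.sum_sub_distrib]
  have hXc : ∀ i ω ω', (∀ a ∈ S i, ω a = ω' a) → X i ω = X i ω' := by
    intro i ω ω' H
    simp only [hX, cInd, indS_congr (S i) ω ω' H]
  rw [hW]
  have main := tikhomirov (prodBern n p h) s (shr S) X ?_ ?_ ?_ ?_ t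
  · refine main.trans ?_
    refine mul_le_mul_of_nonneg_left ?_ (by positivity)
    unfold tripleErr tripSum
    rw [mul_div_assoc, Finset.sum_div, Finset.mul_sum]
    refine Finset.sum_le_sum fun i hi => ?_
    rw [Finset.sum_div, Finset.mul_sum]
    refine Finset.sum_le_sum fun j hj => ?_
    rw [Finset.sum_div, Finset.mul_sum]
    refine Finset.sum_le_sum fun k hk => ?_
    have hj' := (Finset.mem_filter.1 hj).1
    have hk' := (Finset.mem_filter.1 hk).1
    have mb := moment_bound p h (S i) (S j) (S k) (hS i hi) (hS j hj') (hS k hk')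
    have e1 : ∀ ω, |X i ω * X j ω * X k ω|
        = |cInd m p (S i) ω * cInd m p (S j) ω * cInd m p (S k) ω| * (1 / √v ^ 3) := by
      intro ω
      simp only [hX, abs_mul, abs_div, abs_of_pos hsv]; field_simp
    have e2 : ∀ ω, |X i ω * X j ω|
        = |cInd m p (S i) ω * cInd m p (S j) ω| * (1 / √v ^ 2) := by
      intro ω
      simp only [hX, abs_mul, abs_div, abs_of_pos hsv]; field_simp
    have e3 : ∀ ω, |X k ω| = |cInd m p (S k) ω| * (1 / √v) := by
      intro ω
      simp only [hX, abs_div, abs_of_pos hsv]; field_simp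
    simp_rw [e1, e2, e3, integral_mul_const]
    calc _ = ((∫ ω, |cInd m p (S i) ω * cInd m p (S j) ω * cInd m p (S k) ω| ∂(prodBern n p h)) +
      (∫ ω, |cInd m p (S i) ω * cInd m p (S j) ω| ∂(prodBern n p h)) *
        ∫ ω, |cInd m p (S k) ω| ∂(prodBern n p h)) / √v ^ 3 := by field_simp
      _ ≤ (2 * momC m * ((1 - p) * (p : ℝ) ^ (S i ∪ S j ∪ S k).card)) / √v ^ 3 := by gcongr
      _ = _ := by ring
  · intro i hi
    simp only [hX]
    rw [integral_div, integral_cInd p h (S i) (hS i hi), zero_div]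
  · intro i hi
    refine indep_of_disjoint p h (S i) (S i)ᶜ disjoint_compl_right _ _ (hXc i) ?_
    intro ω ω' H
    refine Finset.sum_congr rfl fun j hj => hXc j ω ω' fun a ha => H a ?_
    have hd := (Finset.mem_filter.1 hj).2
    simp only [shr, not_not] at hd
    exact Finset.mem_compl.2 fun hai => Finset.disjoint_left.1 hd hai ha
  · intro i hi j hj
    refine indep_of_disjoint p h (S i ∪ S j) (S i ∪ S j)ᶜ disjoint_compl_right _ _ ?_ ?_
    · intro ω ω' H
      have a1 := hXc i ω ω' (fun a ha => H a (Finset.mem_union_left _ ha))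
      have a2 := hXc j ω ω' (fun a ha => H a (Finset.mem_union_right _ ha))
      simp only [a1, a2]
    · intro ω ω' H
      refine Finset.sum_congr rfl fun k hk => hXc k ω ω' fun a ha => H a ?_
      have hd := (Finset.mem_filter.1 hk).2
      simp only [shr, not_or, not_not] at hd
      refine Finset.mem_compl.2 fun hai => ?_
      rcases Finset.mem_union.1 hai with h' | h'
      · exact Finset.disjoint_left.1 hd.1 h' ha
      · exact Finset.disjoint_left.1 hd.2 h' ha
  · have : ∀ i ∈ s, ∑ j ∈ s with shr S i j, ∫ ω, X i ω * X j ω ∂(prodBern n p h)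
        = (∑ j ∈ s, ∫ ω, cInd m p (S i) ω * cInd m p (S j) ω ∂(prodBern n p h)) / v := by
      intro i hi
      rw [Finset.sum_filter_of_ne]
      · rw [Finset.sum_div]
        refine Finset.sum_congr rfl fun j hj => ?_
        rw [← integral_div]
        congr 1; ext ω
        simp only [hX]
        rw [div_mul_div_comm, Real.mul_self_sqrt hv0.le]
      · intro j hj hne
        by_contra hd'
        have hd : Disjoint (S i) (S j) := not_not.1 hd'
        apply hne
        have : ∀ ω, X i ω * X j ω = cInd m p (S i) ω * cInd m p (S j) ω / v := by
          intro ω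
          simp only [hX]
          rw [div_mul_div_comm, Real.mul_self_sqrt hv0.le]
        simp_rw [this]
        rw [integral_div, integral_cInd_mul p h _ _ (hS i hi) (hS j hj),
          Finset.card_union_of_disjoint hd, hS i hi, hS j hj, two_mul]
        simp
    rw [Finset.sum_congr rfl this, ← Finset.sum_div]
    unfold covSum at hv
    rw [← hv, div_self hv0.ne']

end Bern

section LinAlg

variable {r m : ℕ}

/-- Rational kernel vectors vanishing on `Q`. -/
def kerQ (A : Matrix (Fin r) (Fin m) ℤ) (Q : Finset (Fin m)) : Submodule ℚ (Fin m → ℚ) where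
  carrier := {x | (A.map (Int.cast : ℤ → ℚ)).mulVec x = 0 ∧ ∀ j ∈ Q, x j = 0}
  add_mem' := by
    rintro x y ⟨h1, h2⟩ ⟨h3, h4⟩
    refine ⟨by rw [Matrix.mulVec_add, h1, h3, add_zero], fun j hj => ?_⟩
    simp [h2 j hj, h4 j hj]
  zero_mem' := ⟨by simp, by simp⟩
  smul_mem' := by
    rintro c x ⟨h1, h2⟩
    refine ⟨by rw [Matrix.mulVec_smul, h1, smul_zero], fun j hj => ?_⟩
    simp [h2 j hj]

lemma mem_kerQ (A : Matrix (Fin r) (Fin m) ℤ) (Q : Finset (Fin m)) (x : Fin m → ℚ) :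
    x ∈ kerQ A Q ↔ (A.map (Int.cast : ℤ → ℚ)).mulVec x = 0 ∧ ∀ j ∈ Q, x j = 0 := Iff.rfl

/-- Dimension of `kerQ`. -/
noncomputable def dimQ (A : Matrix (Fin r) (Fin m) ℤ) (Q : Finset (Fin m)) : ℕ :=
  Module.finrank ℚ (kerQ A Q)

lemma dimQ_mono (A : Matrix (Fin r) (Fin m) ℤ) {Q Q' : Finset (Fin m)} (h : Q ⊆ Q') :
    dimQ A Q' ≤ dimQ A Q :=
  Submodule.finrank_mono fun _ hx => ⟨hx.1, fun j hj => hx.2 j (h hj)⟩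

lemma mulVec_restrict (A : Matrix (Fin r) (Fin m) ℤ) (Q : Finset (Fin m)) (x : Fin m → ℚ)
    (hx : ∀ j ∈ Q, x j = 0) :
    ((colSub A Qᶜ).map (Int.cast : ℤ → ℚ)).mulVec (fun j => x j)
      = (A.map (Int.cast : ℤ → ℚ)).mulVec x := by
  ext i
  simp only [Matrix.mulVec, dotProduct, colSub, Matrix.map_apply, Matrix.submatrix_apply, id]
  rw [Finset.sum_coe_sort (Qᶜ) (fun j => (A i j : ℚ) * x j)]
  refine Finset.sum_subset (Finset.subset_univ _) fun j _ hj => ?_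
  rw [hx j (by simpa using hj), mul_zero]

lemma dimQ_add (A : Matrix (Fin r) (Fin m) ℤ) (Q : Finset (Fin m)) :
    dimQ A Q + rkZ (colSub A Qᶜ) + Q.card = m := by
  have hmem : ∀ x : kerQ A Q, (fun j : (Qᶜ : Finset (Fin m)) => x.1 j) ∈
      LinearMap.ker (((colSub A Qᶜ).map (Int.cast : ℤ → ℚ)).mulVecLin) := by
    intro x
    rw [LinearMap.mem_ker, Matrix.mulVecLin_apply, mulVec_restrict A Q x.1 x.2.2, x.2.1]
  let f : kerQ A Q →ₗ[ℚ] LinearMap.ker (((colSub A Qᶜ).map (Int.cast : ℤ → ℚ)).mulVecLin) :=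
    { toFun := fun x => ⟨_, hmem x⟩, map_add' := fun _ _ => rfl, map_smul' := fun _ _ => rfl }
  have hinj : Function.Injective f := by
    intro x y hxy
    ext j
    by_cases hj : j ∈ Q
    · rw [x.2.2 j hj, y.2.2 j hj]
    · have := congrFun (congrArg Subtype.val hxy) ⟨j, by simpa using hj⟩
      exact this
  have hsurj : Function.Surjective f := by
    intro y
    have hy := y.2
    rw [LinearMap.mem_ker, Matrix.mulVecLin_apply] at hy
    let x : Fin m → ℚ := fun j => if h : j ∈ Qᶜ then y.1 ⟨j, h⟩ else 0
    have hx0 : ∀ j ∈ Q, x j = 0 := fun j hj => by simp [x, hj]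
    have hxy : (fun j : (Qᶜ : Finset (Fin m)) => x j) = y.1 := by
      ext j
      have := j.2
      simp only [x, this, dif_pos]
    refine ⟨⟨x, ?_, hx0⟩, ?_⟩
    · rw [← mulVec_restrict A Q x hx0, hxy, hy]
    · exact Subtype.ext hxy
  let e := LinearEquiv.ofBijective f ⟨hinj, hsurj⟩
  have h1 := LinearMap.finrank_range_add_finrank_ker
    (((colSub A Qᶜ).map (Int.cast : ℤ → ℚ)).mulVecLin)
  rw [← e.finrank_eq, Module.finrank_fintype_fun_eq_card, Fintype.card_coe] at h1
  have h2 := Finset.card_compl_add_card Q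
  rw [Fintype.card_fin] at h2
  unfold dimQ rkZ Matrix.rank
  omega

lemma exists_coords : ∀ (d : ℕ) (K : Submodule ℚ (Fin m → ℚ)), Module.finrank ℚ K = d →
    ∃ J : Finset (Fin m), J.card ≤ d ∧ ∀ x ∈ K, (∀ j ∈ J, x j = 0) → x = 0 := by
  intro d
  induction d with
  | zero =>
    intro K hK
    refine ⟨∅, by simp, fun x hx _ => ?_⟩
    have := Submodule.finrank_eq_zero.1 hK
    rw [this] at hx
    exact (Submodule.mem_bot ℚ).1 hx
  | succ d ih =>
    intro K hK
    have hne : K ≠ ⊥ := by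
      rintro rfl
      simp at hK
    obtain ⟨x, hx, hx0⟩ := Submodule.exists_mem_ne_zero_of_ne_bot hne
    obtain ⟨j, hj⟩ := Function.ne_iff.1 hx0
    have hlt : K ⊓ LinearMap.ker (LinearMap.proj (R := ℚ) (φ := fun _ : Fin m => ℚ) j) < K := by
      refine lt_of_le_of_ne inf_le_left fun h => ?_
      rw [← h] at hx
      exact hj (by simpa using hx.2)
    have hr := Submodule.finrank_lt_finrank_of_lt hlt
    obtain ⟨J', hJ'⟩ : ∃ J : Finset (Fin m), J.card ≤ d ∧
        ∀ x ∈ K ⊓ LinearMap.ker (LinearMap.proj (R := ℚ) (φ := fun _ : Fin m => ℚ) j),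
          (∀ j ∈ J, x j = 0) → x = 0 := by
      have hadd := Submodule.finrank_sup_add_finrank_inf_eq K
        (LinearMap.ker (LinearMap.proj (R := ℚ) (φ := fun _ : Fin m => ℚ) j))
      have h1 : Module.finrank ℚ (LinearMap.ker (LinearMap.proj (R := ℚ) (φ := fun _ : Fin m => ℚ) j)) + 1 = m := by
        have := LinearMap.finrank_range_add_finrank_ker (LinearMap.proj (R := ℚ) (φ := fun _ : Fin m => ℚ) j)
        rw [LinearMap.range_eq_top.2 (LinearMap.proj_surjective j)] at this
        simp at this
        omega
      have h2 := Submodule.finrank_le (K ⊔ LinearMap.ker (LinearMap.proj (R := ℚ) (φ := fun _ : Fin m => ℚ) j))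
      rw [Module.finrank_fintype_fun_eq_card, Fintype.card_fin] at h2
      exact ih _ (by omega)
    refine ⟨insert j J', (Finset.card_insert_le _ _).trans (by omega), fun x hx h => ?_⟩
    refine hJ'.2 x ⟨hx, ?_⟩ fun i hi => h i (Finset.mem_insert_of_mem hi)
    exact h j (Finset.mem_insert_self _ _)

lemma cast_mulVec (A : Matrix (Fin r) (Fin m) ℤ) (x : Fin m → ℤ) :
    (A.map (Int.cast : ℤ → ℚ)).mulVec (fun j => (x j : ℚ)) = fun i => ((A.mulVec x i : ℤ) : ℚ) := by
  ext i
  simp [Matrix.mulVec, dotProduct]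

lemma exists_int_vectors (A : Matrix (Fin r) (Fin m) ℤ) (Q : Finset (Fin m)) :
    ∃ v : Fin (dimQ A Q) → Fin m → ℤ, (∀ i, A.mulVec (v i) = 0) ∧ (∀ i, ∀ j ∈ Q, v i j = 0) ∧
      ∀ a : Fin (dimQ A Q) → ℤ, (∀ j, ∑ i, a i * v i j = 0) → a = 0 := by
  let B : Module.Basis (Fin (dimQ A Q)) ℚ (kerQ A Q) := Module.finBasis ℚ (kerQ A Q)
  obtain ⟨N, hN⟩ := IsLocalization.exist_integer_multiples_of_finite (nonZeroDivisors ℤ)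
    (fun q : Fin (dimQ A Q) × Fin m => (B q.1 : Fin m → ℚ) q.2)
  choose v hv using hN
  have hN0 : ((N : ℤ) : ℚ) ≠ 0 := by
    exact_mod_cast nonZeroDivisors.coe_ne_zero N
  have hv' : ∀ i j, ((v (i, j) : ℤ) : ℚ) = ((N : ℤ) : ℚ) * (B i : Fin m → ℚ) j := by
    intro i j
    have := hv (i, j)
    simpa using this
  refine ⟨fun i j => v (i, j), fun i => ?_, fun i j hj => ?_, fun a ha => ?_⟩
  · have h1 := cast_mulVec A (fun j => v (i, j))
    have h2 : (fun j => ((v (i, j) : ℤ) : ℚ)) = ((N : ℤ) : ℚ) • (B i : Fin m → ℚ) := by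
      ext j; rw [hv']; simp
    rw [h2, Matrix.mulVec_smul, (B i).2.1, smul_zero] at h1
    ext k
    have := congrFun h1 k
    simp only [Pi.zero_apply] at this ⊢
    exact_mod_cast this.symm
  · have := hv' i j
    rw [(B i).2.2 j hj, mul_zero] at this
    exact_mod_cast this
  · have hli := B.linearIndependent
    rw [Fintype.linearIndependent_iff] at hli
    have := hli (fun i => (a i : ℚ)) (by
      ext j
      have h := ha j
      have h' : ((∑ i, a i * v (i, j) : ℤ) : ℚ) = 0 := by rw [h]; simp
      push_cast at h'
      simp only [hv'] at h'
      have h'' : ((N : ℤ) : ℚ) * ∑ i, (a i : ℚ) * (B i : Fin m → ℚ) j = 0 := by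
        rw [← h', Finset.mul_sum]
        exact Finset.sum_congr rfl fun i _ => by ring
      have h3 := (mul_eq_zero.1 h'').resolve_left hN0
      simpa using h3)
    ext i
    exact_mod_cast this i

lemma exists_generic (A : Matrix (Fin r) (Fin m) ℤ) (hA : IsPositiveMat A) :
    ∃ u : Fin m → ℤ, A.mulVec u = 0 ∧ (∀ j, 0 < u j) ∧ ∀ i j, i ≠ j → u i ≠ u j := by
  have key : ∀ P : Finset (Fin m × Fin m), ∃ u : Fin m → ℤ, A.mulVec u = 0 ∧ (∀ j, 0 < u j) ∧
      ∀ q ∈ P, q.1 ≠ q.2 → u q.1 ≠ u q.2 := by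
    intro P
    induction P using Finset.induction_on with
    | empty =>
      obtain ⟨x, h1, h2⟩ := hA.1
      exact ⟨x, h1, h2, by simp⟩
    | insert q P hq ih =>
      obtain ⟨x, h1, h2, h3⟩ := ih
      by_cases hqq : q.1 = q.2
      · refine ⟨x, h1, h2, fun q' hq' hne => ?_⟩
        rcases Finset.mem_insert.1 hq' with rfl | h
        · exact absurd hqq hne
        · exact h3 q' h hne
      obtain ⟨y, hy1, hy2⟩ := hA.2 q.1 q.2 hqq
      set C : ℤ := ∑ j, |y j| with hC
      have hyC : ∀ j, |y j| ≤ C := fun j =>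
        Finset.single_le_sum (f := fun j => |y j|) (fun _ _ => abs_nonneg _) (Finset.mem_univ j)
      have hC0 : 0 ≤ C := Finset.sum_nonneg fun _ _ => abs_nonneg _
      have hbig : ∀ i j, x i ≠ x j → (2 * C + 1) * x i + y i ≠ (2 * C + 1) * x j + y j := by
        intro i j hij heq
        have a1 := abs_le.1 (hyC i)
        have a2 := abs_le.1 (hyC j)
        rcases lt_or_gt_of_ne hij with h | h
        · nlinarith
        · nlinarith
      refine ⟨(2 * C + 1) • x + y, ?_, fun j => ?_, fun q' hq' hne => ?_⟩
      · rw [Matrix.mulVec_add, Matrix.mulVec_smul, h1, hy1]; simp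
      · have a1 := abs_le.1 (hyC j)
        have := h2 j
        simp only [Pi.add_apply, Pi.smul_apply, smul_eq_mul]
        nlinarith
      · simp only [Pi.add_apply, Pi.smul_apply, smul_eq_mul]
        rcases Finset.mem_insert.1 hq' with rfl | h
        · by_cases hx : x q'.1 = x q'.2
          · rw [hx]
            intro h
            exact hy2 (by linarith)
          · exact hbig _ _ hx
        · exact hbig _ _ (h3 q' h hne)
  obtain ⟨u, h1, h2, h3⟩ := key Finset.univ
  exact ⟨u, h1, h2, fun i j hij => h3 (i, j) (Finset.mem_univ _) hij⟩

/-- The solutions in `[n]`, indexed by functions to `Fin n`. -/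
noncomputable def solF (A : Matrix (Fin r) (Fin m) ℤ) (b : Fin r → ℤ) (n : ℕ) :
    Finset (Fin m → Fin n) :=
  Finset.univ.filter fun y => (fun j => (((y j : ℕ) : ℤ) + 1)) ∈ properSols A b

lemma solF_inj {A : Matrix (Fin r) (Fin m) ℤ} {b : Fin r → ℤ} {n : ℕ} {y : Fin m → Fin n}
    (hy : y ∈ solF A b n) : Function.Injective y := by
  intro i j hij
  refine (Finset.mem_filter.1 hy).2.2 ?_
  simp only [hij]

lemma fibre_count (A : Matrix (Fin r) (Fin m) ℤ) (b : Fin r → ℤ) (n : ℕ) (Q : Finset (Fin m))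
    (s : Finset (Fin m → Fin n)) (hs : s ⊆ solF A b n)
    (hQ : ∀ y ∈ s, ∀ z ∈ s, ∀ j ∈ Q, y j = z j) (hn : 0 < n) :
    s.card ≤ n ^ dimQ A Q := by
  obtain ⟨J, hJ, hJ0⟩ := exists_coords _ (kerQ A Q) rfl
  have : s.card ≤ (Finset.univ : Finset (J → Fin n)).card := by
    refine Finset.card_le_card_of_injOn (fun y j => y j) (fun _ _ => Finset.mem_univ _) ?_
    intro y hy z hz hyz
    have hyS := (Finset.mem_filter.1 (hs hy)).2.1
    have hzS := (Finset.mem_filter.1 (hs hz)).2.1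
    set Y : Fin m → ℤ := fun j => (((y j : ℕ) : ℤ) + 1)
    set Z : Fin m → ℤ := fun j => (((z j : ℕ) : ℤ) + 1)
    have h0 : A.mulVec (Y - Z) = 0 := by rw [Matrix.mulVec_sub, hyS, hzS, sub_self]
    have hK : (fun j => (((Y - Z) j : ℤ) : ℚ)) ∈ kerQ A Q := by
      rw [mem_kerQ]
      refine ⟨?_, fun j hj => ?_⟩
      · rw [cast_mulVec, h0]; ext; simp
      · have := hQ y hy z hz j hj
        simp [Y, Z, this]
    have hz0 := hJ0 _ hK (fun j hj => by
      have := congrFun hyz ⟨j, hj⟩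
      simp only at this
      simp [Y, Z, this])
    ext j
    have := congrFun hz0 j
    simp [Y, Z] at this
    have h3 : ((y j : ℕ) : ℚ) = (z j : ℕ) := by linarith
    exact_mod_cast h3
  refine this.trans ?_
  rw [Finset.card_univ, Fintype.card_fun, Fintype.card_fin, Fintype.card_coe]
  exact Nat.pow_le_pow_right hn hJ

lemma fibre_count_set (A : Matrix (Fin r) (Fin m) ℤ) (b : Fin r → ℤ) (n : ℕ) (Q : Finset (Fin m))
    (V : Finset (Fin n)) (hn : 0 < n) (hV : V.card ≤ 2 * m) (hm : 0 < m) :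
    ((solF A b n).filter fun y => ∀ j ∈ Q, y j ∈ V).card ≤ n ^ dimQ A Q * (2 * m) ^ m := by
  have h1 := Finset.card_le_mul_card_image_of_maps_to
    (s := (solF A b n).filter fun y => ∀ j ∈ Q, y j ∈ V)
    (t := Fintype.piFinset (fun _ : Q => V)) (f := fun y (j : Q) => y j)
    (fun y hy => by
      rw [Fintype.mem_piFinset]
      exact fun j => (Finset.mem_filter.1 hy).2 j j.2) (n ^ dimQ A Q)
    (fun w _ => by
      refine fibre_count A b n Q _ ?_ ?_ hn
      · exact (Finset.filter_subset _ _).trans (Finset.filter_subset _ _)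
      · intro y hy z hz j hj
        have hy' := congrFun (Finset.mem_filter.1 hy).2 ⟨j, hj⟩
        have hz' := congrFun (Finset.mem_filter.1 hz).2 ⟨j, hj⟩
        exact hy'.trans hz'.symm)
  refine h1.trans (Nat.mul_le_mul_left _ ?_)
  rw [Fintype.card_piFinset]
  simp only [Finset.prod_const, Finset.card_univ, Fintype.card_coe]
  calc V.card ^ Q.card ≤ (2 * m) ^ Q.card := Nat.pow_le_pow_left hV _
    _ ≤ _ := Nat.pow_le_pow_right (by omega) (by simpa using Finset.card_le_univ Q)

/-- The sum `Ψ`. -/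
noncomputable def psi (A : Matrix (Fin r) (Fin m) ℤ) (n : ℕ) (p : ℝ) : ℝ :=
  ∑ Q ∈ (Finset.univ : Finset (Finset (Fin m))).filter Finset.Nonempty,
    (n : ℝ) ^ dimQ A Q * p ^ (m - Q.card)

lemma link_sum (A : Matrix (Fin r) (Fin m) ℤ) (b : Fin r → ℤ) (n : ℕ) (p : ℝ) (hp : 0 ≤ p)
    (V : Finset (Fin n)) (hn : 0 < n) (hV : V.card ≤ 2 * m) (hm : 0 < m)
    (s : Finset (Fin m → Fin n)) (hs : s ⊆ solF A b n) (hs2 : ∀ z ∈ s, ∃ j, z j ∈ V) :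
    ∑ z ∈ s, p ^ (Finset.univ.filter fun j => z j ∉ V).card ≤ (2 * m) ^ m * psi A n p := by
  rw [← Finset.sum_fiberwise_of_maps_to
    (g := fun z : Fin m → Fin n => Finset.univ.filter fun j => z j ∈ V)
    (t := (Finset.univ : Finset (Finset (Fin m))).filter Finset.Nonempty)]
  · unfold psi
    rw [Finset.mul_sum]
    refine Finset.sum_le_sum fun Q _ => ?_
    have : ∀ z ∈ s.filter (fun z => (Finset.univ.filter fun j => z j ∈ V) = Q),
        p ^ (Finset.univ.filter fun j => z j ∉ V).card = p ^ (m - Q.card) := by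
      intro z hz
      congr 1
      rw [← (Finset.mem_filter.1 hz).2]
      have := Finset.card_filter_add_card_filter_not (s := (Finset.univ : Finset (Fin m)))
        (fun j => z j ∈ V)
      rw [Finset.card_univ, Fintype.card_fin] at this
      omega
    rw [Finset.sum_congr rfl this, Finset.sum_const, nsmul_eq_mul, ← mul_assoc]
    refine mul_le_mul_of_nonneg_right ?_ (by positivity)
    have hc : (s.filter (fun z => (Finset.univ.filter fun j => z j ∈ V) = Q)).card
        ≤ n ^ dimQ A Q * (2 * m) ^ m := by
      refine le_trans (Finset.card_le_card ?_) (fibre_count_set A b n Q V hn hV hm)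
      intro z hz
      rw [Finset.mem_filter] at hz ⊢
      refine ⟨hs hz.1, fun j hj => ?_⟩
      rw [← hz.2] at hj
      exact (Finset.mem_filter.1 hj).2
    have : ((s.filter (fun z => (Finset.univ.filter fun j => z j ∈ V) = Q)).card : ℝ)
        ≤ ((n ^ dimQ A Q * (2 * m) ^ m : ℕ) : ℝ) := by exact_mod_cast hc
    refine this.trans (le_of_eq ?_)
    push_cast; ring
  · intro z hz
    obtain ⟨j, hj⟩ := hs2 z hz
    simp only [Finset.mem_filter, Finset.mem_univ, true_and]
    exact ⟨j, by simpa using hj⟩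

end LinAlg

section Lower

variable {r m : ℕ}

lemma sum_coef_bound {d : ℕ} (v : Fin d → Fin m → ℤ) (V : ℤ) (hV : ∀ j, ∑ i, |v i j| ≤ V)
    (s : ℕ) (a : Fin d → Fin s) (j : Fin m) :
    |∑ i, ((a i : ℕ) : ℤ) * v i j| ≤ V * s := by
  refine (Finset.abs_sum_le_sum_abs _ _).trans ?_
  calc ∑ i, |((a i : ℕ) : ℤ) * v i j| ≤ ∑ i, |v i j| * s := by
        refine Finset.sum_le_sum fun i _ => ?_
        rw [abs_mul, mul_comm]
        refine mul_le_mul_of_nonneg_left ?_ (abs_nonneg _)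
        rw [abs_of_nonneg (by positivity)]
        exact_mod_cast (a i).2.le
    _ = (∑ i, |v i j|) * s := by rw [Finset.sum_mul]
    _ ≤ V * s := mul_le_mul_of_nonneg_right (hV j) (by positivity)

lemma box_sol (A : Matrix (Fin r) (Fin m) ℤ) (b : Fin r → ℤ) (x0 u : Fin m → ℤ)
    (hx0 : A.mulVec x0 = b) (hu : A.mulVec u = 0) (hu0 : ∀ j, 0 < u j)
    (hu1 : ∀ i j, i ≠ j → u i ≠ u j) (V U : ℤ) (hV : 0 ≤ V) (hU : ∀ j, u j ≤ U)
    (n s : ℕ) (hs : 1 ≤ s) (hB : ∀ j, |x0 j| ≤ s)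
    (hn : (s : ℤ) * (1 + (4 * V + 3) * U + 2 * V) ≤ n)
    (δ : Fin m → ℤ) (hδ : A.mulVec δ = 0) (hδ1 : ∀ j, |δ j| ≤ 2 * V * s) :
    ∃ y ∈ solF A b n, ∀ j, (((y j : ℕ) : ℤ) + 1) = x0 j + (4 * V + 3) * s * u j + δ j := by
  set X : Fin m → ℤ := fun j => x0 j + (4 * V + 3) * s * u j + δ j with hX
  have hs' : (1 : ℤ) ≤ s := by exact_mod_cast hs
  have hMs : 0 < (4 * V + 3) * (s : ℤ) := by positivity
  have hlow : ∀ j, 1 ≤ X j := by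
    intro j
    have h1 := abs_le.1 (hB j)
    have h2 := abs_le.1 (hδ1 j)
    have h3 : (4 * V + 3) * (s : ℤ) * 1 ≤ (4 * V + 3) * s * u j :=
      mul_le_mul_of_nonneg_left (hu0 j) hMs.le
    have h4 : 0 ≤ V * s := by positivity
    simp only [hX]
    nlinarith
  have hup : ∀ j, X j ≤ n := by
    intro j
    have h1 := abs_le.1 (hB j)
    have h2 := abs_le.1 (hδ1 j)
    have h3 : (4 * V + 3) * (s : ℤ) * u j ≤ (4 * V + 3) * s * U :=
      mul_le_mul_of_nonneg_left (hU j) hMs.le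
    simp only [hX]
    nlinarith
  have hinj : Function.Injective X := by
    have key : ∀ i j, u i < u j → X i ≠ X j := by
      intro i j hij h
      have h1 := abs_le.1 (hB j)
      have h2 := abs_le.1 (hδ1 j)
      have h1' := abs_le.1 (hB i)
      have h2' := abs_le.1 (hδ1 i)
      have h3 : (4 * V + 3) * (s : ℤ) * 1 ≤ (4 * V + 3) * s * (u j - u i) :=
        mul_le_mul_of_nonneg_left (by omega) hMs.le
      simp only [hX] at h
      nlinarith
    intro i j hij
    by_contra hne
    rcases lt_or_gt_of_ne (hu1 i j hne) with h | h
    · exact key i j h hij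
    · exact key j i h hij.symm
  have hA : A.mulVec X = b := by
    have : X = x0 + ((4 * V + 3) * (s : ℤ)) • u + δ := by
      ext j; simp [hX]
    rw [this, Matrix.mulVec_add, Matrix.mulVec_add, Matrix.mulVec_smul, hx0, hu, hδ]
    simp
  have hval : ∀ j, (((X j - 1).toNat : ℕ) : ℤ) + 1 = X j := by
    intro j
    have := hlow j
    omega
  refine ⟨fun j => ⟨(X j - 1).toNat, by have := hlow j; have := hup j; omega⟩, ?_, fun j => hval j⟩
  unfold solF
  rw [Finset.mem_filter]
  refine ⟨Finset.mem_univ _, ?_⟩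
  have : (fun j => ((((X j - 1).toNat : ℕ) : ℤ) + 1)) = X := funext hval
  simp only [this]
  exact ⟨hA, hinj⟩

/-- Agreement on a set of coordinates. -/
def agree {n : ℕ} (Q : Finset (Fin m)) (x y : Fin m → Fin n) : Prop := ∀ j ∈ Q, x j = y j

lemma mulVec_comb (A : Matrix (Fin r) (Fin m) ℤ) {d : ℕ} (v : Fin d → Fin m → ℤ)
    (hv : ∀ i, A.mulVec (v i) = 0) (a : Fin d → ℤ) :
    A.mulVec (fun j => ∑ i, a i * v i j) = 0 := by
  have : (fun j => ∑ i, a i * v i j) = ∑ i, a i • v i := by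
    ext j; simp
  rw [this, Matrix.mulVec_sum]
  refine Finset.sum_eq_zero fun i _ => ?_
  rw [Matrix.mulVec_smul, hv, smul_zero]

lemma comb_inj {d s : ℕ} (v : Fin d → Fin m → ℤ)
    (hv : ∀ a : Fin d → ℤ, (∀ j, ∑ i, a i * v i j = 0) → a = 0) (a a' : Fin d → Fin s)
    (h : ∀ j, ∑ i, ((a i : ℕ) : ℤ) * v i j = ∑ i, ((a' i : ℕ) : ℤ) * v i j) : a = a' := by
  have := hv (fun i => ((a i : ℕ) : ℤ) - ((a' i : ℕ) : ℤ)) (fun j => by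
    simp only [sub_mul, Finset.sum_sub_distrib]
    rw [h j, sub_self])
  ext i
  have := congrFun this i
  simp only [Pi.zero_apply] at this
  omega

lemma pair_lower (A : Matrix (Fin r) (Fin m) ℤ) (hA : IsPositiveMat A) (b : Fin r → ℤ)
    (hb : ∃ x : Fin m → ℤ, A.mulVec x = b) (Q : Finset (Fin m)) :
    ∃ κ : ℝ, 0 < κ ∧ ∀ᶠ n : ℕ in atTop, κ * ((n : ℝ) ^ dimQ A ∅ * (n : ℝ) ^ dimQ A Q) ≤
      (((solF A b n) ×ˢ (solF A b n)).filter (fun q => agree Q q.1 q.2)).card := by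
  obtain ⟨x0, hx0⟩ := hb
  obtain ⟨u, hu, hu0, hu1⟩ := exists_generic A hA
  obtain ⟨v, hv1, -, hv3⟩ := exists_int_vectors A ∅
  obtain ⟨w, hw1, hw2, hw3⟩ := exists_int_vectors A Q
  set V : ℤ := ∑ j, (∑ i, |v i j| + ∑ i, |w i j|) with hVdef
  have hVj : ∀ j, ∑ i, |v i j| + ∑ i, |w i j| ≤ V := fun j =>
    Finset.single_le_sum (f := fun j => ∑ i, |v i j| + ∑ i, |w i j|)
      (fun _ _ => by positivity) (Finset.mem_univ j)
  have hV0 : 0 ≤ V := Finset.sum_nonneg fun _ _ => by positivity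
  have hvV : ∀ j, ∑ i, |v i j| ≤ V := fun j => by
    have h1 := hVj j
    have h2 : 0 ≤ ∑ i, |w i j| := by positivity
    omega
  have hwV : ∀ j, ∑ i, |w i j| ≤ V := fun j => by
    have h1 := hVj j
    have h2 : 0 ≤ ∑ i, |v i j| := by positivity
    omega
  set U : ℤ := ∑ j, u j with hUdef
  have hU : ∀ j, u j ≤ U := fun j =>
    Finset.single_le_sum (f := u) (fun i _ => (hu0 i).le) (Finset.mem_univ j)
  have hU0 : 0 ≤ U := Finset.sum_nonneg fun i _ => (hu0 i).le
  set B : ℤ := ∑ j, |x0 j| with hBdef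
  have hB : ∀ j, |x0 j| ≤ B := fun j =>
    Finset.single_le_sum (f := fun j => |x0 j|) (fun _ _ => abs_nonneg _) (Finset.mem_univ j)
  obtain ⟨K, hK⟩ : ∃ K : ℕ, (K : ℤ) = 1 + (4 * V + 3) * U + 2 * V :=
    ⟨(1 + (4 * V + 3) * U + 2 * V).toNat, Int.toNat_of_nonneg (by positivity)⟩
  have hK0 : 0 < K := by
    have : (0 : ℤ) < K := by rw [hK]; positivity
    exact_mod_cast this
  refine ⟨((1 : ℝ) / (2 * K)) ^ (dimQ A ∅ + dimQ A Q), by positivity, ?_⟩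
  filter_upwards [eventually_ge_atTop ((B.toNat + 1) * (2 * K))] with n hn
  set s := n / K with hs
  have hsB : B.toNat + 1 ≤ s := by
    rw [hs, Nat.le_div_iff_mul_le hK0]
    nlinarith
  have hs1 : 1 ≤ s := by omega
  have hsK : (s : ℤ) * (1 + (4 * V + 3) * U + 2 * V) ≤ n := by
    rw [← hK]
    exact_mod_cast Nat.div_mul_le_self n K
  have hBs : ∀ j, |x0 j| ≤ s := fun j => by
    have := hB j
    omega
  have hsn : (n : ℝ) * (1 / (2 * K)) ≤ s := by
    have h1 : n < K * (s + 1) := by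
      rw [hs]; exact Nat.lt_mul_div_succ n hK0
    have h2 : (n : ℝ) ≤ K * (s + 1) := by exact_mod_cast h1.le
    have h3 : (1 : ℝ) ≤ s := by exact_mod_cast hs1
    have h4 : (0 : ℝ) < K := by exact_mod_cast hK0
    rw [mul_one_div, div_le_iff₀ (by positivity)]
    nlinarith
  have hbox := box_sol A b x0 u hx0 hu hu0 hu1 V U hV0 hU n s hs1 hBs hsK
  have hX : ∀ a : Fin (dimQ A ∅) → Fin s, ∃ y ∈ solF A b n, ∀ j, (((y j : ℕ) : ℤ) + 1)
      = x0 j + (4 * V + 3) * s * u j + ∑ i, ((a i : ℕ) : ℤ) * v i j := by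
    intro a
    refine hbox _ (mulVec_comb A v hv1 _) fun j => ?_
    have := sum_coef_bound v V hvV s a j
    have h0 : 0 ≤ V * s := by positivity
    linarith
  have hY : ∀ q : (Fin (dimQ A ∅) → Fin s) × (Fin (dimQ A Q) → Fin s), ∃ y ∈ solF A b n,
      ∀ j, (((y j : ℕ) : ℤ) + 1) = x0 j + (4 * V + 3) * s * u j +
        (∑ i, ((q.1 i : ℕ) : ℤ) * v i j + ∑ i, ((q.2 i : ℕ) : ℤ) * w i j) := by
    intro q
    refine hbox (fun j => ∑ i, ((q.1 i : ℕ) : ℤ) * v i j + ∑ i, ((q.2 i : ℕ) : ℤ) * w i j) ?_ fun j => ?_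
    · have h1 := mulVec_comb A v hv1 (fun i => ((q.1 i : ℕ) : ℤ))
      have h2 := mulVec_comb A w hw1 (fun i => ((q.2 i : ℕ) : ℤ))
      have h3 := Matrix.mulVec_add A (fun j => ∑ i, ((q.1 i : ℕ) : ℤ) * v i j)
        (fun j => ∑ i, ((q.2 i : ℕ) : ℤ) * w i j)
      rw [h1, h2, add_zero] at h3
      exact h3
    · have h1 := sum_coef_bound v V hvV s q.1 j
      have h2 := sum_coef_bound w V hwV s q.2 j
      have h3 := abs_add_le (∑ i, ((q.1 i : ℕ) : ℤ) * v i j) (∑ i, ((q.2 i : ℕ) : ℤ) * w i j)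
      linarith
  choose X hX1 hX2 using hX
  choose Y hY1 hY2 using hY
  have hcard : s ^ dimQ A ∅ * s ^ dimQ A Q ≤
      (((solF A b n) ×ˢ (solF A b n)).filter (fun q => agree Q q.1 q.2)).card := by
    have h1 : (Finset.univ : Finset ((Fin (dimQ A ∅) → Fin s) × (Fin (dimQ A Q) → Fin s))).card
        = s ^ dimQ A ∅ * s ^ dimQ A Q := by
      rw [Finset.card_univ, Fintype.card_prod, Fintype.card_fun, Fintype.card_fun]
      simp
    rw [← h1]
    refine Finset.card_le_card_of_injOn (fun q => (X q.1, Y q)) ?_ ?_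
    · intro q _
      rw [Finset.mem_coe, Finset.mem_filter, Finset.mem_product]
      refine ⟨⟨hX1 _, hY1 _⟩, fun j hj => ?_⟩
      have e1 := hX2 q.1 j
      have e2 := hY2 q j
      have e3 : ∑ i, ((q.2 i : ℕ) : ℤ) * w i j = 0 :=
        Finset.sum_eq_zero fun i _ => by rw [hw2 i j hj, mul_zero]
      rw [e3, add_zero, ← e1] at e2
      ext
      show ((X q.1 j : ℕ)) = (Y q j : ℕ)
      omega
    · intro q _ q' _ h
      have h1 : X q.1 = X q'.1 := congrArg Prod.fst h
      have h2 : Y q = Y q' := congrArg Prod.snd h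
      have g1 : q.1 = q'.1 := by
        refine comb_inj v hv3 _ _ fun j => ?_
        have e1 := hX2 q.1 j
        have e2 := hX2 q'.1 j
        rw [h1, e2] at e1
        linarith
      have g2 : q.2 = q'.2 := by
        refine comb_inj w hw3 _ _ fun j => ?_
        have e1 := hY2 q j
        have e2 := hY2 q' j
        rw [h2, e2, g1] at e1
        linarith
      exact Prod.ext g1 g2
  have hcardR : ((s : ℝ) ^ dimQ A ∅ * (s : ℝ) ^ dimQ A Q) ≤
      (((solF A b n) ×ˢ (solF A b n)).filter (fun q => agree Q q.1 q.2)).card := by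
    exact_mod_cast hcard
  refine le_trans ?_ hcardR
  rw [← pow_add, ← pow_add, ← mul_pow]
  refine pow_le_pow_left₀ (by positivity) ?_ _
  rw [mul_comm]; exact hsn

end Lower

section Combine

variable {r m : ℕ}

/-- The set of values of a solution. -/
noncomputable def img {n : ℕ} (y : Fin m → Fin n) : Finset (Fin n) := Finset.univ.image y

lemma img_card {n : ℕ} {y : Fin m → Fin n} (hy : Function.Injective y) : (img y).card = m := by
  unfold img
  rw [Finset.card_image_of_injective _ hy, Finset.card_univ, Fintype.card_fin]

lemma card_union_img {n : ℕ} (V : Finset (Fin n)) {z : Fin m → Fin n}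
    (hz : Function.Injective z) :
    (V ∪ img z).card = V.card + (Finset.univ.filter fun j => z j ∉ V).card := by
  have h1 : V ∪ img z = V ∪ (Finset.univ.filter fun j => z j ∉ V).image z := by
    ext a
    simp only [img, Finset.mem_union, Finset.mem_image, Finset.mem_univ, true_and,
      Finset.mem_filter]
    constructor
    · rintro (h | ⟨j, rfl⟩)
      · exact Or.inl h
      · by_cases h : z j ∈ V
        · exact Or.inl h
        · exact Or.inr ⟨j, h, rfl⟩
    · rintro (h | ⟨j, _, rfl⟩)
      · exact Or.inl h
      · exact Or.inr ⟨j, rfl⟩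
  rw [h1, Finset.card_union_of_disjoint, Finset.card_image_of_injective _ hz]
  rw [Finset.disjoint_left]
  intro a ha h
  obtain ⟨j, hj, rfl⟩ := Finset.mem_image.1 h
  exact (Finset.mem_filter.1 hj).2 ha

lemma shr_exists {n : ℕ} {y z : Fin m → Fin n} (h : shr img y z) : ∃ j, z j ∈ img y := by
  unfold shr at h
  rw [Finset.not_disjoint_iff] at h
  obtain ⟨a, h1, h2⟩ := h
  obtain ⟨j, _, rfl⟩ := Finset.mem_image.1 h2
  exact ⟨j, h1⟩

lemma psi_nonneg (A : Matrix (Fin r) (Fin m) ℤ) (n : ℕ) (p : ℝ) (hp : 0 ≤ p) : 0 ≤ psi A n p :=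
  Finset.sum_nonneg fun _ _ => by positivity

lemma trip_bound (A : Matrix (Fin r) (Fin m) ℤ) (b : Fin r → ℤ) (n : ℕ) (p : ℝ≥0)
    (hn : 0 < n) (hm : 0 < m) :
    tripSum p (solF A b n) img ≤
      (n : ℝ) ^ dimQ A ∅ * (p : ℝ) ^ m * ((2 * m) ^ m * psi A n p) ^ 2 := by
  set L : ℝ := (2 * m) ^ m * psi A n p with hL
  have hp : (0 : ℝ) ≤ p := p.2
  have hL0 : 0 ≤ L := mul_nonneg (by positivity) (psi_nonneg A n p hp)
  have hin : ∀ x ∈ solF A b n, ∀ y ∈ solF A b n,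
      ∑ k ∈ solF A b n with (shr img x k ∨ shr img y k), (p : ℝ) ^ (img x ∪ img y ∪ img k).card
        ≤ (p : ℝ) ^ (img x ∪ img y).card * L := by
    intro x hx y hy
    rw [Finset.sum_congr rfl (fun k hk => by
      rw [card_union_img (img x ∪ img y) (solF_inj (Finset.mem_filter.1 hk).1), pow_add]),
      ← Finset.mul_sum]
    refine mul_le_mul_of_nonneg_left ?_ (by positivity)
    refine link_sum A b n p hp (img x ∪ img y) hn ?_ hm _ (Finset.filter_subset _ _) ?_
    · have := Finset.card_union_le (img x) (img y)
      rw [img_card (solF_inj hx), img_card (solF_inj hy)] at this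
      omega
    · intro z hz
      rcases (Finset.mem_filter.1 hz).2 with h | h
      · obtain ⟨j, hj⟩ := shr_exists h
        exact ⟨j, Finset.mem_union_left _ hj⟩
      · obtain ⟨j, hj⟩ := shr_exists h
        exact ⟨j, Finset.mem_union_right _ hj⟩
  have hmid : ∀ x ∈ solF A b n,
      ∑ y ∈ solF A b n with shr img x y, (p : ℝ) ^ (img x ∪ img y).card ≤ (p : ℝ) ^ m * L := by
    intro x hx
    rw [Finset.sum_congr rfl (fun k hk => by
      rw [card_union_img (img x) (solF_inj (Finset.mem_filter.1 hk).1), pow_add,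
        img_card (solF_inj hx)]), ← Finset.mul_sum]
    refine mul_le_mul_of_nonneg_left ?_ (by positivity)
    refine link_sum A b n p hp (img x) hn ?_ hm _ (Finset.filter_subset _ _) ?_
    · rw [img_card (solF_inj hx)]; omega
    · intro z hz
      exact shr_exists (Finset.mem_filter.1 hz).2
  unfold tripSum
  calc _ ≤ ∑ x ∈ solF A b n, (p : ℝ) ^ m * L * L := by
        refine Finset.sum_le_sum fun x hx => ?_
        calc _ ≤ ∑ y ∈ solF A b n with shr img x y, (p : ℝ) ^ (img x ∪ img y).card * L :=
              Finset.sum_le_sum fun y hy => hin x hx y (Finset.mem_filter.1 hy).1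
          _ ≤ _ := by
              rw [← Finset.sum_mul]
              exact mul_le_mul_of_nonneg_right (hmid x hx) hL0
    _ = (solF A b n).card * ((p : ℝ) ^ m * L * L) := by rw [Finset.sum_const, nsmul_eq_mul]
    _ ≤ (n : ℝ) ^ dimQ A ∅ * ((p : ℝ) ^ m * L * L) := by
        refine mul_le_mul_of_nonneg_right ?_ (by positivity)
        exact_mod_cast fibre_count A b n ∅ _ (Finset.Subset.refl _) (by simp) hn
    _ = _ := by ring

lemma cov_bound (A : Matrix (Fin r) (Fin m) ℤ) (b : Fin r → ℤ) (n : ℕ) (p : ℝ≥0) (h : p ≤ 1)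
    (κ : ℝ)
    (hκ : ∀ Q : Finset (Fin m), κ * ((n : ℝ) ^ dimQ A ∅ * (n : ℝ) ^ dimQ A Q) ≤
      (((solF A b n) ×ˢ (solF A b n)).filter (fun q => agree Q q.1 q.2)).card) :
    κ * ((1 - p) * ((n : ℝ) ^ dimQ A ∅ * (p : ℝ) ^ m) * psi A n p)
      ≤ 2 ^ m * covSum p h m (solF A b n) img := by
  have hp : (0 : ℝ) ≤ p := p.2
  have hp1 : (p : ℝ) ≤ 1 := by exact_mod_cast h
  have hq0 : (0 : ℝ) ≤ 1 - p := by linarith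
  have hcov : covSum p h m (solF A b n) img = ∑ q ∈ (solF A b n) ×ˢ (solF A b n),
      ∫ ω, cInd m p (img q.1) ω * cInd m p (img q.2) ω ∂(prodBern n p h) := by
    unfold covSum
    rw [Finset.sum_product]
  have hnn : ∀ q ∈ (solF A b n) ×ˢ (solF A b n),
      0 ≤ ∫ ω, cInd m p (img q.1) ω * cInd m p (img q.2) ω ∂(prodBern n p h) := by
    intro q hq
    rw [Finset.mem_product] at hq
    exact cov_nonneg p h _ _ (img_card (solF_inj hq.1)) (img_card (solF_inj hq.2))
  have hcov0 : 0 ≤ covSum p h m (solF A b n) img := by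
    rw [hcov]; exact Finset.sum_nonneg hnn
  have hone : ∀ Q : Finset (Fin m), Q.Nonempty →
      κ * ((1 - p) * ((n : ℝ) ^ dimQ A ∅ * (p : ℝ) ^ m)
        * ((n : ℝ) ^ dimQ A Q * (p : ℝ) ^ (m - Q.card))) ≤ covSum p h m (solF A b n) img := by
    intro Q hQ
    have hQm : Q.card ≤ m := by simpa using Finset.card_le_univ Q
    have e : (p : ℝ) ^ (2 * m - Q.card) = (p : ℝ) ^ m * (p : ℝ) ^ (m - Q.card) := by
      rw [← pow_add]; congr 1; omega
    calc _ = κ * ((n : ℝ) ^ dimQ A ∅ * (n : ℝ) ^ dimQ A Q) *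
            ((1 - p) * (p : ℝ) ^ (2 * m - Q.card)) := by rw [e]; ring
      _ ≤ (((solF A b n) ×ˢ (solF A b n)).filter (fun q => agree Q q.1 q.2)).card *
            ((1 - p) * (p : ℝ) ^ (2 * m - Q.card)) :=
          mul_le_mul_of_nonneg_right (hκ Q) (by positivity)
      _ = ∑ q ∈ ((solF A b n) ×ˢ (solF A b n)).filter (fun q => agree Q q.1 q.2),
            ((1 - p) * (p : ℝ) ^ (2 * m - Q.card)) := by rw [Finset.sum_const, nsmul_eq_mul]
      _ ≤ ∑ q ∈ ((solF A b n) ×ˢ (solF A b n)).filter (fun q => agree Q q.1 q.2),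
          ∫ ω, cInd m p (img q.1) ω * cInd m p (img q.2) ω ∂(prodBern n p h) := by
          refine Finset.sum_le_sum fun q hq => ?_
          rw [Finset.mem_filter, Finset.mem_product] at hq
          refine cov_lower p h _ _ (img_card (solF_inj hq.1.1)) (img_card (solF_inj hq.1.2))
            (Finset.card_pos.2 hQ) ?_
          rw [← Finset.card_image_of_injective Q (solF_inj hq.1.1)]
          refine Finset.card_le_card fun a ha => ?_
          obtain ⟨j, hj, rfl⟩ := Finset.mem_image.1 ha
          rw [Finset.mem_inter]
          refine ⟨Finset.mem_image_of_mem _ (Finset.mem_univ _), ?_⟩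
          rw [hq.2 j hj]
          exact Finset.mem_image_of_mem _ (Finset.mem_univ _)
      _ ≤ _ := by
          rw [hcov]
          exact Finset.sum_le_sum_of_subset_of_nonneg (Finset.filter_subset _ _)
            fun q hq _ => hnn q hq
  unfold psi
  rw [Finset.mul_sum, Finset.mul_sum]
  calc _ ≤ ∑ Q ∈ (Finset.univ : Finset (Finset (Fin m))).filter Finset.Nonempty,
        covSum p h m (solF A b n) img :=
        Finset.sum_le_sum fun Q hQ => hone Q (Finset.mem_filter.1 hQ).2
    _ ≤ ∑ Q : Finset (Fin m), covSum p h m (solF A b n) img :=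
        Finset.sum_le_sum_of_subset_of_nonneg (Finset.filter_subset _ _) fun _ _ _ => hcov0
    _ = _ := by
        rw [Finset.sum_const, nsmul_eq_mul, Finset.card_univ, Fintype.card_finset, Fintype.card_fin]
        push_cast; rfl

lemma pair_lower_all (A : Matrix (Fin r) (Fin m) ℤ) (hA : IsPositiveMat A) (b : Fin r → ℤ)
    (hb : ∃ x : Fin m → ℤ, A.mulVec x = b) :
    ∃ κ : ℝ, 0 < κ ∧ ∀ᶠ n : ℕ in atTop, ∀ Q : Finset (Fin m),
      κ * ((n : ℝ) ^ dimQ A ∅ * (n : ℝ) ^ dimQ A Q) ≤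
      (((solF A b n) ×ˢ (solF A b n)).filter (fun q => agree Q q.1 q.2)).card := by
  choose κ h1 h2 using fun Q => pair_lower A hA b hb Q
  obtain ⟨Q0, -, hQ0⟩ := Finset.exists_min_image Finset.univ κ Finset.univ_nonempty
  refine ⟨κ Q0, h1 Q0, ?_⟩
  filter_upwards [eventually_all.2 h2] with n hn Q
  refine le_trans ?_ (hn Q)
  exact mul_le_mul_of_nonneg_right (hQ0 Q (Finset.mem_univ _)) (by positivity)

/-! Dimension facts. -/

lemma dim_empty (A : Matrix (Fin r) (Fin m) ℤ) (hA : IsAbundantMat A) :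
    dimQ A ∅ + rkZ A = m := by
  have h := dimQ_add A ∅
  rw [hA.2 (∅ᶜ) (by simp)] at h
  simpa using h

lemma dim_lt (A : Matrix (Fin r) (Fin m) ℤ) (hA : IsAbundantMat A) (Q : Finset (Fin m))
    (hQ : Q.Nonempty) : dimQ A Q + 1 ≤ dimQ A ∅ := by
  obtain ⟨i, hi⟩ := hQ
  have h1 := dimQ_mono A (Finset.singleton_subset_iff.2 hi)
  have h2 := dimQ_add A {i}
  have h3 := dim_empty A hA
  rw [hA.2 ({i}ᶜ) (by rw [Finset.card_compl, Finset.card_singleton]; omega),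
    Finset.card_singleton] at h2
  omega

lemma card_le_density (A : Matrix (Fin r) (Fin m) ℤ) (hA : IsAbundantMat A) (Q : Finset (Fin m))
    (hQ : Q.Nonempty) :
    (Q.card : ℝ) ≤ matDensity A * ((dimQ A ∅ - dimQ A Q : ℕ) : ℝ) := by
  have hlt := dim_lt A hA Q hQ
  have hadd := dimQ_add A Q
  have h0 := dim_empty A hA
  have hc := Finset.card_pos.2 hQ
  have hr : rQ A Q + 1 ≤ Q.card ∧ Q.card ≤ (dimQ A ∅ - dimQ A Q) + rQ A Q := by
    have hcompl : rQ A Q = rkZ A - rkZ (colSub A Qᶜ) := by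
      unfold rQ
      convert rfl
    rw [hcompl]
    omega
  have hr1 : (rQ A Q : ℝ) + 1 ≤ Q.card := by exact_mod_cast hr.1
  have hr2 : (Q.card : ℝ) ≤ ((dimQ A ∅ - dimQ A Q : ℕ) : ℝ) + rQ A Q := by exact_mod_cast hr.2
  have hle : (Q.card : ℝ) / ((Q.card : ℝ) - (rQ A Q : ℝ)) ≤ matDensity A := by
    unfold matDensity
    refine le_csSup ?_ ⟨Q, hQ, rfl⟩
    refine ((Set.toFinite (Set.range fun Q : Finset (Fin m) =>
      (Q.card : ℝ) / ((Q.card : ℝ) - (rQ A Q : ℝ))))).subset ?_ |>.bddAbove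
    rintro x ⟨Q', _, rfl⟩
    exact ⟨Q', rfl⟩
  have hpos : 0 < (Q.card : ℝ) - (rQ A Q : ℝ) := by linarith
  have hcd : 0 ≤ matDensity A := le_trans (by positivity) hle
  rw [div_le_iff₀ hpos] at hle
  exact hle.trans (mul_le_mul_of_nonneg_left (by linarith) hcd)

lemma density_pos (A : Matrix (Fin r) (Fin m) ℤ) (hA : IsAbundantMat A) (hm : 0 < m) :
    0 < matDensity A := by
  have hQ : ({⟨0, hm⟩} : Finset (Fin m)).Nonempty := Finset.singleton_nonempty _
  have h := card_le_density A hA _ hQ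
  rw [Finset.card_singleton] at h
  by_contra hc
  have : matDensity A * ((dimQ A ∅ - dimQ A {⟨0, hm⟩} : ℕ) : ℝ) ≤ 0 :=
    mul_nonpos_of_nonpos_of_nonneg (not_lt.1 hc) (by positivity)
  push_cast at h
  linarith

lemma term_lower {n e q : ℕ} {p c B : ℝ} (hp0 : 0 < p) (hp1 : p ≤ 1) (he : 1 ≤ e) (hn : 1 ≤ n)
    (hq : (q : ℝ) ≤ c * e) (hqm : q ≤ m) (h1 : 2 ^ m * B ≤ n * (1 - p)) (h2 : 1 ≤ n * p ^ c)
    (h3 : 2 * B ≤ n * p ^ c) : B ≤ (1 - p) * ((n : ℝ) ^ e * p ^ q) := by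
  have hn' : (1 : ℝ) ≤ n := by exact_mod_cast hn
  have hq0 : 0 ≤ 1 - p := by linarith
  rcases le_or_gt p (1 / 2) with hp | hp
  · have a1 : p ^ (c * e) ≤ p ^ q := by
      rw [← Real.rpow_natCast p q]
      exact Real.rpow_le_rpow_of_exponent_ge hp0 hp1 hq
    have a2 : n * p ^ c ≤ (n : ℝ) ^ e * p ^ q := by
      calc n * p ^ c ≤ (n * p ^ c) ^ e := le_self_pow₀ h2 (by omega)
        _ = (n : ℝ) ^ e * p ^ (c * e) := by
            rw [mul_pow, Real.rpow_mul hp0.le, Real.rpow_natCast]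
        _ ≤ _ := mul_le_mul_of_nonneg_left a1 (by positivity)
    nlinarith
  · have a1 : (1 / 2 : ℝ) ^ m ≤ p ^ q := by
      calc (1 / 2 : ℝ) ^ m ≤ p ^ m := pow_le_pow_left₀ (by norm_num) hp.le _
        _ ≤ p ^ q := pow_le_pow_of_le_one hp0.le hp1 hqm
    have a2 : (n : ℝ) ≤ (n : ℝ) ^ e := le_self_pow₀ hn' (by omega)
    have a3 : (n : ℝ) * (1 / 2) ^ m ≤ (n : ℝ) ^ e * p ^ q :=
      mul_le_mul a2 a1 (by positivity) (by positivity)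
    have a4 : (1 - p) * ((n : ℝ) * (1 / 2) ^ m) ≤ (1 - p) * ((n : ℝ) ^ e * p ^ q) :=
      mul_le_mul_of_nonneg_left a3 hq0
    refine le_trans ?_ a4
    have a5 : (2 : ℝ) ^ m * (1 / 2) ^ m = 1 := by rw [← mul_pow]; norm_num
    have a6 : (0 : ℝ) < (1 / 2) ^ m := by positivity
    have := mul_le_mul_of_nonneg_right h1 a6.le
    calc B = B * (2 ^ m * (1 / 2) ^ m) := by rw [a5, mul_one]
      _ = 2 ^ m * B * (1 / 2) ^ m := by ring
      _ ≤ _ := this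
      _ = _ := by ring

lemma p_pos_eventually (A : Matrix (Fin r) (Fin m) ℤ) (hA : IsAbundantMat A) (hm : 0 < m)
    (p : ℕ → ℝ≥0)
    (h2 : Tendsto (fun n : ℕ => (n : ℝ) * (p n : ℝ) ^ (matDensity A)) atTop atTop) :
    ∀ᶠ n in atTop, (0 : ℝ) < p n := by
  filter_upwards [h2.eventually_ge_atTop 1] with n hn
  rcases eq_or_lt_of_le (p n).2 with h | h
  · exfalso
    have h' : ((p n : ℝ≥0) : ℝ) = 0 := h.symm
    rw [h', Real.zero_rpow (density_pos A hA hm).ne'] at hn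
    norm_num at hn
  · exact h

lemma ratio_tendsto (A : Matrix (Fin r) (Fin m) ℤ) (hA : IsAbundantMat A) (hm : 0 < m)
    (p : ℕ → ℝ≥0) (hp : ∀ n, p n ≤ 1)
    (h1 : Tendsto (fun n : ℕ => (n : ℝ) * (1 - (p n : ℝ))) atTop atTop)
    (h2 : Tendsto (fun n : ℕ => (n : ℝ) * (p n : ℝ) ^ (matDensity A)) atTop atTop) :
    Tendsto (fun n : ℕ => psi A n (p n) /
      ((1 - (p n : ℝ)) * ((n : ℝ) ^ dimQ A ∅ * (p n : ℝ) ^ m))) atTop (𝓝 0) := by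
  unfold psi
  simp_rw [Finset.sum_div]
  rw [← Finset.sum_const_zero (s := (Finset.univ : Finset (Finset (Fin m))).filter Finset.Nonempty)]
  refine tendsto_finsetSum _ fun Q hQ => ?_
  have hQ' := (Finset.mem_filter.1 hQ).2
  have hQm : Q.card ≤ m := by simpa using Finset.card_le_univ Q
  have hlt := dim_lt A hA Q hQ'
  have key : Tendsto (fun n : ℕ => (1 - (p n : ℝ)) *
      ((n : ℝ) ^ (dimQ A ∅ - dimQ A Q) * (p n : ℝ) ^ Q.card)) atTop atTop := by
    refine tendsto_atTop.2 fun B => ?_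
    filter_upwards [p_pos_eventually A hA hm p h2, h1.eventually_ge_atTop (2 ^ m * B),
      h2.eventually_ge_atTop 1, h2.eventually_ge_atTop (2 * B), eventually_ge_atTop 1]
      with n g1 g2 g3 g4 g5
    exact term_lower g1 (by exact_mod_cast hp n) (by omega) g5
      (card_le_density A hA Q hQ') hQm g2 g3 g4
  refine (tendsto_inv_atTop_zero.comp key).congr' ?_
  filter_upwards [p_pos_eventually A hA hm p h2, eventually_ge_atTop 1] with n g1 g2
  have gn : (0 : ℝ) < n := by exact_mod_cast g2
  have e1 : (n : ℝ) ^ dimQ A ∅ = (n : ℝ) ^ (dimQ A ∅ - dimQ A Q) * (n : ℝ) ^ dimQ A Q := by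
    rw [← pow_add]; congr 1; omega
  have e2 : (p n : ℝ) ^ m = (p n : ℝ) ^ Q.card * (p n : ℝ) ^ (m - Q.card) := by
    rw [← pow_add]; congr 1; omega
  simp only [Function.comp]
  rw [e1, e2]
  have z1 : (n : ℝ) ^ dimQ A Q ≠ 0 := by positivity
  have z2 : (p n : ℝ) ^ (m - Q.card) ≠ 0 := by positivity
  rw [show (1 - (p n : ℝ)) * ((n : ℝ) ^ (dimQ A ∅ - dimQ A Q) * (n : ℝ) ^ dimQ A Q *
      ((p n : ℝ) ^ Q.card * (p n : ℝ) ^ (m - Q.card))) =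
      ((1 - (p n : ℝ)) * ((n : ℝ) ^ (dimQ A ∅ - dimQ A Q) * (p n : ℝ) ^ Q.card)) *
      ((n : ℝ) ^ dimQ A Q * (p n : ℝ) ^ (m - Q.card)) by ring]
  rw [div_mul_cancel_right₀ (mul_ne_zero z1 z2)]

lemma err_sq_bound {F Ψ q κ T v C L : ℝ} (hF : 0 < F) (hΨ : 0 < Ψ) (hq : 0 < q) (hκ : 0 < κ)
    (hT0 : 0 ≤ T) (hT : T ≤ F * (L * Ψ) ^ 2) (hv : κ * (q * F * Ψ) ≤ v) :
    (C * q * T / (√v) ^ 3) ^ 2 ≤ C ^ 2 * L ^ 4 / κ ^ 3 * (Ψ / (q * F)) := by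
  have hw : 0 < κ * (q * F * Ψ) := by positivity
  have hv0 : 0 < v := lt_of_lt_of_le hw hv
  have e : ((√v) ^ 3) ^ 2 = v ^ 3 := by
    rw [← pow_mul, mul_comm 3 2, pow_mul, Real.sq_sqrt hv0.le]
  rw [div_pow, e, mul_pow, mul_pow]
  calc C ^ 2 * q ^ 2 * T ^ 2 / v ^ 3 ≤
      C ^ 2 * q ^ 2 * (F * (L * Ψ) ^ 2) ^ 2 / (κ * (q * F * Ψ)) ^ 3 := by gcongr
    _ = _ := by field_simp

/-! Counting solutions as a sum of indicators. -/

lemma solCount_eq (A : Matrix (Fin r) (Fin m) ℤ) (b : Fin r → ℤ) (n : ℕ) (ω : Fin n → Bool) :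
    (solCount (properSols A b) n ω : ℝ) = ∑ y ∈ solF A b n, indS (img y) ω := by
  have h1 : ∑ y ∈ solF A b n, indS (img y) ω
      = (((solF A b n).filter fun y => ∀ i ∈ img y, ω i = true).card : ℝ) := by
    unfold indS
    rw [Finset.sum_boole]
  rw [h1]
  congr 1
  unfold solCount
  rw [← Fintype.card_coe, ← Nat.card_eq_fintype_card]
  symm
  have hmem : ∀ y : {y // y ∈ (solF A b n).filter fun y => ∀ i ∈ img y, ω i = true},
      (fun j => (((y.1 j : ℕ) : ℤ) + 1)) ∈ properSols A b ∧
        ∀ j, selected ω (((y.1 j : ℕ) : ℤ) + 1) := by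
    intro y
    have hy := Finset.mem_filter.1 y.2
    refine ⟨(Finset.mem_filter.1 hy.1).2, fun j => ⟨y.1 j, rfl, hy.2 _ ?_⟩⟩
    exact Finset.mem_image_of_mem _ (Finset.mem_univ _)
  refine Nat.card_eq_of_bijective (fun y => ⟨_, hmem y⟩) ⟨?_, ?_⟩
  · intro y z hyz
    have h2 := congrArg Subtype.val hyz
    refine Subtype.ext (funext fun j => Fin.ext ?_)
    have := congrFun h2 j
    simp only at this
    omega
  · rintro ⟨x, hx, hsel⟩
    have hsel2 := hsel
    choose y hy1 hy2 using hsel2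
    have hxy : (fun j => (((y j : ℕ) : ℤ) + 1)) = x := funext fun j => (hy1 j).symm
    refine ⟨⟨y, ?_⟩, Subtype.ext hxy⟩
    rw [Finset.mem_filter]
    refine ⟨Finset.mem_filter.2 ⟨Finset.mem_univ _, ?_⟩, fun i hi => ?_⟩
    · rw [hxy]; exact hx
    · obtain ⟨j, _, rfl⟩ := Finset.mem_image.1 hi
      exact hy2 j

lemma psi_pos (A : Matrix (Fin r) (Fin m) ℤ) (hm : 0 < m) (n : ℕ) (hn : 0 < n) (p : ℝ)
    (hp : 0 < p) : 0 < psi A n p := by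
  have hn' : (0 : ℝ) < n := by exact_mod_cast hn
  refine Finset.sum_pos (fun Q _ => by positivity) ?_
  exact ⟨{⟨0, hm⟩}, Finset.mem_filter.2 ⟨Finset.mem_univ _, Finset.singleton_nonempty _⟩⟩

lemma tripSum_nonneg {ι : Type*} {n : ℕ} (p : ℝ≥0) (s : Finset ι) (S : ι → Finset (Fin n)) :
    0 ≤ tripSum p s S :=
  Finset.sum_nonneg fun _ _ => Finset.sum_nonneg fun _ _ => Finset.sum_nonneg fun _ _ => by
    positivity

/-- The normalised solution count. -/
noncomputable def normCount (A : Matrix (Fin r) (Fin m) ℤ) (b : Fin r → ℤ) (n : ℕ) (p : ℝ≥0)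
    (h : p ≤ 1) (ω : Fin n → Bool) : ℝ :=
  ((solCount (properSols A b) n ω : ℝ) -
      ∫ ω', (solCount (properSols A b) n ω' : ℝ) ∂ prodBern n p h) /
    Real.sqrt (variance (fun ω' => (solCount (properSols A b) n ω' : ℝ)) (prodBern n p h))

lemma normCount_eq (A : Matrix (Fin r) (Fin m) ℤ) (b : Fin r → ℤ) (n : ℕ) (p : ℝ≥0)
    (h : p ≤ 1) : normCount A b n p h = fun ω =>
      (∑ y ∈ solF A b n, indS (img y) ω - (solF A b n).card * (p : ℝ) ^ m) /
        √(covSum p h m (solF A b n) img) := by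
  have hS : ∀ y ∈ solF A b n, (img y).card = m := fun y hy => img_card (solF_inj hy)
  ext ω
  unfold normCount
  simp_rw [solCount_eq]
  rw [sum_ind_mean p h _ img hS, sum_ind_variance p h _ img hS]

lemma cf_tendsto (hm : 0 < m) (A : Matrix (Fin r) (Fin m) ℤ) (hApos : IsPositiveMat A)
    (hAab : IsAbundantMat A) (b : Fin r → ℤ) (hb : ∃ x : Fin m → ℤ, A.mulVec x = b)
    (p : ℕ → ℝ≥0) (hp : ∀ n, p n ≤ 1)
    (h1 : Tendsto (fun n : ℕ => (n : ℝ) * (1 - (p n : ℝ))) atTop atTop)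
    (h2 : Tendsto (fun n : ℕ => (n : ℝ) * (p n : ℝ) ^ (matDensity A)) atTop atTop) (t : ℝ) :
    Tendsto (fun n => cf (prodBern n (p n) (hp n)) (normCount A b n (p n) (hp n)) t) atTop
      (𝓝 (Complex.exp (-(t ^ 2 / 2 : ℝ)))) := by
  obtain ⟨κ, hκ0, hκ⟩ := pair_lower_all A hApos b hb
  set R : ℕ → ℝ := fun n => psi A n (p n) /
      ((1 - (p n : ℝ)) * ((n : ℝ) ^ dimQ A ∅ * (p n : ℝ) ^ m)) with hR
  set L : ℝ := (2 * m) ^ m with hL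
  set D : ℝ := (2 * momC m) ^ 2 * L ^ 4 / (κ / 2 ^ m) ^ 3 with hD
  have hRt := ratio_tendsto A hAab hm p hp h1 h2
  have hlim : Tendsto (fun n => 3 * |t| ^ 3 * Real.exp (t ^ 2 / 2) * √(D * R n)) atTop (𝓝 0) := by
    have a1 : Tendsto (fun n => √(D * R n)) atTop (𝓝 0) := by
      have := (hRt.const_mul D).sqrt
      simpa using this
    simpa using a1.const_mul (3 * |t| ^ 3 * Real.exp (t ^ 2 / 2))
  rw [tendsto_iff_norm_sub_tendsto_zero]
  refine squeeze_zero' (Eventually.of_forall fun _ => norm_nonneg _) ?_ hlim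
  filter_upwards [hκ, p_pos_eventually A hAab hm p h2, h1.eventually_gt_atTop 0,
    eventually_ge_atTop 1] with n g1 g2 g3 g4
  have gn : (0 : ℝ) < n := by exact_mod_cast g4
  have gq : 0 < 1 - (p n : ℝ) := by
    by_contra hc
    have := mul_nonpos_of_nonneg_of_nonpos gn.le (not_lt.1 hc)
    linarith
  have hΨ := psi_pos A hm n g4 (p n) g2
  have hF : 0 < (n : ℝ) ^ dimQ A ∅ * (p n : ℝ) ^ m := by positivity
  set v := covSum (p n) (hp n) m (solF A b n) img with hv
  have hcov := cov_bound A b n (p n) (hp n) κ g1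
  have hcov' : κ / 2 ^ m * ((1 - (p n : ℝ)) * ((n : ℝ) ^ dimQ A ∅ * (p n : ℝ) ^ m) *
      psi A n (p n)) ≤ v := by
    rw [div_mul_eq_mul_div, div_le_iff₀ (by positivity)]
    linarith
  have hv0 : 0 < v := lt_of_lt_of_le (by positivity) hcov'
  have hb1 := bern_clt_bound (p n) (hp n) (solF A b n) img
    (fun y hy => img_card (solF_inj hy)) v hv hv0 t
  rw [normCount_eq]
  refine hb1.trans (mul_le_mul_of_nonneg_left ?_ (by positivity))
  refine Real.le_sqrt_of_sq_le ?_
  exact err_sq_bound hF hΨ gq (by positivity) (tripSum_nonneg _ _ _)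
    (trip_bound A b n (p n) g4 hm) hcov'

end Combine

/-- **Theorem (distribution of proper solutions).** -/
theorem properSolutions_clt {r m : ℕ} (hr : 0 < r) (hrm : r < m)
    (A : Matrix (Fin r) (Fin m) ℤ) (hApos : IsPositiveMat A) (hAab : IsAbundantMat A)
    (b : Fin r → ℤ) (hb : ∃ x : Fin m → ℤ, A.mulVec x = b)
    (p : ℕ → ℝ≥0) (hp : ∀ n, p n ≤ 1)
    (h1 : Tendsto (fun n : ℕ => (n : ℝ) * (1 - (p n : ℝ))) atTop atTop)
    (h2 : Tendsto (fun n : ℕ => (n : ℝ) * (p n : ℝ) ^ (matDensity A)) atTop atTop) :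
    ∀ f : ℝ →ᵇ ℝ,
      Tendsto (fun n : ℕ =>
          ∫ ω, f (((solCount (properSols A b) n ω : ℝ) -
              ∫ ω', (solCount (properSols A b) n ω' : ℝ) ∂ prodBern n (p n) (hp n)) /
            Real.sqrt (variance (fun ω' => (solCount (properSols A b) n ω' : ℝ))
              (prodBern n (p n) (hp n)))) ∂ prodBern n (p n) (hp n))
        atTop (𝓝 (∫ x, f x ∂ gaussianReal 0 1)) := by
  intro f
  have hm : 0 < m := by omega
  have hmeas : ∀ n, AEMeasurable (normCount A b n (p n) (hp n)) (prodBern n (p n) (hp n)) :=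
    fun n => Measurable.of_discrete.aemeasurable
  let μ : ℕ → ProbabilityMeasure ℝ := fun n =>
    ⟨(prodBern n (p n) (hp n)).map (normCount A b n (p n) (hp n)),
      Measure.isProbabilityMeasure_map (hmeas n)⟩
  let μ₀ : ProbabilityMeasure ℝ := ⟨gaussianReal 0 1, inferInstance⟩
  have hconv : Tendsto μ atTop (𝓝 μ₀) := by
    rw [ProbabilityMeasure.tendsto_iff_tendsto_charFun]
    intro t
    have e1 : ∀ n, charFun (μ n : Measure ℝ) t
        = cf (prodBern n (p n) (hp n)) (normCount A b n (p n) (hp n)) t := by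
      intro n
      rw [charFun_apply_real]
      change ∫ x, _ ∂((prodBern n (p n) (hp n)).map (normCount A b n (p n) (hp n))) = _
      rw [integral_map (hmeas n) (Continuous.aestronglyMeasurable (by fun_prop))]
      unfold cf
      simp
    have e2 : charFun (μ₀ : Measure ℝ) t = Complex.exp (-(t ^ 2 / 2 : ℝ)) := by
      change charFun (gaussianReal 0 1) t = _
      rw [charFun_gaussianReal]
      congr 1
      push_cast
      ring
    simp_rw [e1]
    rw [e2]
    exact cf_tendsto hm A hApos hAab b hb p hp h1 h2 t
  rw [ProbabilityMeasure.tendsto_iff_forall_integral_tendsto] at hconv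
  have h3 := hconv f
  refine h3.congr fun n => ?_
  change ∫ x, f x ∂((prodBern n (p n) (hp n)).map (normCount A b n (p n) (hp n))) = _
  rw [integral_map (hmeas n) f.continuous.aestronglyMeasurable]
  rfl
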